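/- arXiv:2105.11930 — 2 statements merged into one kernel-verified Lean document; each statement's English description precedes it below -/
import Mathlib

section
/- Let r and ρ be smooth, strictly positive functions on [0,2π] × [t₀,t₁], 2π-periodic in θ, where r solves the radial equation of Gage's area-preserving flow, ∂r/∂t = (1/g²)∂²r/∂θ² − (2/(r g²))(∂r/∂θ)² − r/g² + 2πg/(rL) with g = √(r² + (∂r/∂θ)²), L(t) = ∫₀^{2π} g dθ, and ρ solves the radial curve shortening flow equation, ∂ρ/∂t = (1/g_ρ²)∂²ρ/∂θ² − (2/(ρ g_ρ²))(∂ρ/∂θ)² − ρ/g_ρ² with g_ρ = √(ρ² + (∂ρ/∂θ)²). If r(θ, t₀) = ρ(θ, t₀) for all θ, then r(θ,t) ≥ ρ(θ,t) for all (θ,t) ∈ [0,2π] × [t₀,t₁]. -/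
open Real Set MeasureTheory Filter

noncomputable section
/-- First partial derivative in `θ` of a radial function `r(θ, t)`. -/
def rdθ (r : ℝ → ℝ → ℝ) (θ t : ℝ) : ℝ := deriv (fun u => r u t) θ

/-- Second partial derivative in `θ` of a radial function `r(θ, t)`. -/
def rdθθ (r : ℝ → ℝ → ℝ) (θ t : ℝ) : ℝ := deriv (deriv (fun u => r u t)) θ

/-- The metric `g = √(r² + (∂r/∂θ)²)` of the polar curve with radial function `r`. -/
def rmet (r : ℝ → ℝ → ℝ) (θ t : ℝ) : ℝ := Real.sqrt (r θ t ^ 2 + rdθ r θ t ^ 2)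

/-- The length `L(t) = ∫₀^{2π} g dθ` of the polar curve with radial function `r`. -/
def rlen (r : ℝ → ℝ → ℝ) (t : ℝ) : ℝ := ∫ θ in (0:ℝ)..(2 * π), rmet r θ t

/-- The radial equation of Gage's area-preserving flow
`∂r/∂t = (1/g²) ∂²r/∂θ² − (2/(r g²)) (∂r/∂θ)² − r/g² + 2πg/(rL)` on the time set `I`. -/
def RadialGAPF (r : ℝ → ℝ → ℝ) (I : Set ℝ) : Prop :=
  ∀ t ∈ I, ∀ θ : ℝ,
    HasDerivWithinAt (fun τ => r θ τ)
      (rdθθ r θ t / rmet r θ t ^ 2 - 2 / (r θ t * rmet r θ t ^ 2) * rdθ r θ t ^ 2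
        - r θ t / rmet r θ t ^ 2 + 2 * π * rmet r θ t / (r θ t * rlen r t)) I t

/-- The radial equation of the curve shortening flow
`∂ρ/∂t = (1/g²) ∂²ρ/∂θ² − (2/(ρ g²)) (∂ρ/∂θ)² − ρ/g²` on the time set `I`. -/
def RadialCSF (ρ : ℝ → ℝ → ℝ) (I : Set ℝ) : Prop :=
  ∀ t ∈ I, ∀ θ : ℝ,
    HasDerivWithinAt (fun τ => ρ θ τ)
      (rdθθ ρ θ t / rmet ρ θ t ^ 2 - 2 / (ρ θ t * rmet ρ θ t ^ 2) * rdθ ρ θ t ^ 2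
        - ρ θ t / rmet ρ θ t ^ 2) I t

theorem rdθ_eq_fderivWithin {f : ℝ → ℝ → ℝ} {t₀ t₁ : ℝ}
    (hf : ContDiffOn ℝ (⊤ : ℕ∞) (fun p : ℝ × ℝ => f p.1 p.2) (Set.univ ×ˢ Set.Icc t₀ t₁))
    (θ t : ℝ) (ht : t ∈ Set.Icc t₀ t₁) :
    HasDerivAt (fun u => f u t) (fderivWithin ℝ (fun p : ℝ × ℝ => f p.1 p.2)
      (Set.univ ×ˢ Set.Icc t₀ t₁) (θ, t) (1, 0)) θ := by
  have h1 : HasFDerivWithinAt (fun p : ℝ × ℝ => f p.1 p.2) _ (Set.univ ×ˢ Set.Icc t₀ t₁) (θ, t) :=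
    ((hf.differentiableOn (by simp)) (θ, t) ⟨trivial, ht⟩).hasFDerivWithinAt
  have h2 : HasDerivWithinAt (fun u : ℝ => (u, t)) ((1 : ℝ), (0 : ℝ)) Set.univ θ :=
    ((hasDerivAt_id θ).prodMk (hasDerivAt_const θ t)).hasDerivWithinAt
  have h3 := h1.comp_hasDerivWithinAt (f := fun u : ℝ => (u, t)) θ h2
    (fun u _ => (⟨trivial, ht⟩ : (u, t) ∈ Set.univ ×ˢ Set.Icc t₀ t₁))
  exact hasDerivWithinAt_univ.1 h3

theorem contDiffOn_rdθ {f : ℝ → ℝ → ℝ} {t₀ t₁ : ℝ} (h01 : t₀ < t₁)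
    (hf : ContDiffOn ℝ (⊤ : ℕ∞) (fun p : ℝ × ℝ => f p.1 p.2) (Set.univ ×ˢ Set.Icc t₀ t₁)) :
    ContDiffOn ℝ (⊤ : ℕ∞) (fun p : ℝ × ℝ => rdθ f p.1 p.2) (Set.univ ×ˢ Set.Icc t₀ t₁) := by
  have hu : UniqueDiffOn ℝ ((Set.univ : Set ℝ) ×ˢ Set.Icc t₀ t₁) :=
    uniqueDiffOn_univ.prod (uniqueDiffOn_Icc h01)
  have h := (hf.fderivWithin hu (m := (⊤ : ℕ∞)) (by simp)).clm_apply
    (contDiffOn_const (c := ((1 : ℝ), (0 : ℝ))))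
  refine h.congr ?_
  rintro ⟨θ, t⟩ ⟨-, ht⟩
  exact (rdθ_eq_fderivWithin hf θ t ht).deriv

theorem hasDerivAt_rdθ {f : ℝ → ℝ → ℝ} {t₀ t₁ : ℝ}
    (hf : ContDiffOn ℝ (⊤ : ℕ∞) (fun p : ℝ × ℝ => f p.1 p.2) (Set.univ ×ˢ Set.Icc t₀ t₁))
    (θ t : ℝ) (ht : t ∈ Set.Icc t₀ t₁) :
    HasDerivAt (fun u => f u t) (rdθ f θ t) θ :=
  (rdθ_eq_fderivWithin hf θ t ht).differentiableAt.hasDerivAt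

theorem second_deriv_nonneg_of_min {w w' : ℝ → ℝ} {w'' x : ℝ}
    (h1 : ∀ u, HasDerivAt w (w' u) u) (h2 : HasDerivAt w' w'' x) (hmin : IsLocalMin w x) :
    0 ≤ w'' := by
  by_contra! hneg
  have hd : deriv w = w' := funext fun u => (h1 u).deriv
  have hmax : IsLocalMax w x := by
    apply isLocalMax_of_deriv_deriv_neg
    · rw [hd, h2.deriv]; exact hneg
    · exact hmin.deriv_eq_zero
    · exact (h1 x).continuousAt
  have hc : w =ᶠ[nhds x] fun _ => w x := by
    filter_upwards [hmin, hmax] with u a b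
    exact le_antisymm b a
  have hc2 := hc.deriv
  have : deriv (deriv w) x = 0 := by
    rw [hc2.deriv_eq]; simp
  rw [hd, h2.deriv] at this
  linarith

theorem left_deriv_nonpos_of_min {φ : ℝ → ℝ} {φ' a b t : ℝ} (hat : a < t) (htb : t ≤ b)
    (h : HasDerivWithinAt φ φ' (Set.Icc a b) t) (hmin : ∀ s ∈ Set.Icc a b, φ t ≤ φ s) :
    φ' ≤ 0 := by
  have hm : IsLocalMinOn φ (Set.Icc a b) t :=
    IsMinOn.localize (fun s hs => hmin s hs)
  have hy : a - t ∈ posTangentConeAt (Set.Icc a b) t := by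
    apply sub_mem_posTangentConeAt_of_segment_subset
    exact (convex_Icc a b).segment_subset ⟨hat.le, htb⟩ ⟨le_rfl, hat.le.trans htb⟩
  have := hm.hasFDerivWithinAt_nonneg h.hasFDerivWithinAt hy
  simp at this
  nlinarith

theorem csf_diff_identity (a b p q : ℝ) (ha : 0 < a) (hb : 0 < b) :
    (q / (a ^ 2 + p ^ 2) - 2 / (a * (a ^ 2 + p ^ 2)) * p ^ 2 - a / (a ^ 2 + p ^ 2))
      - (q / (b ^ 2 + p ^ 2) - 2 / (b * (b ^ 2 + p ^ 2)) * p ^ 2 - b / (b ^ 2 + p ^ 2))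
    = (b - a) * ((q * (a + b) * (a * b) - 2 * p ^ 2 * (a ^ 2 + a * b + b ^ 2 + p ^ 2)
        + (p ^ 2 - a * b) * (a * b)) / (a * b * (a ^ 2 + p ^ 2) * (b ^ 2 + p ^ 2))) := by
  have hA : a ^ 2 + p ^ 2 ≠ 0 := by positivity
  have hB : b ^ 2 + p ^ 2 ≠ 0 := by positivity
  field_simp
  ring

theorem rmet_sq (r : ℝ → ℝ → ℝ) (θ t : ℝ) : rmet r θ t ^ 2 = r θ t ^ 2 + rdθ r θ t ^ 2 :=
  Real.sq_sqrt (by positivity)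

/-- Comparison principle: a positive periodic solution of the radial Gage
area-preserving flow equation stays above the positive periodic solution of the radial
curve shortening flow equation with the same value at the initial time `t₀`. -/
theorem radial_gapf_dominates_radial_csf
    (r ρ : ℝ → ℝ → ℝ) (t₀ t₁ : ℝ) (ht : t₀ ≤ t₁)
    (hrsmooth : ContDiffOn ℝ (⊤ : ℕ∞) (fun p : ℝ × ℝ => r p.1 p.2)
      (Set.univ ×ˢ Set.Icc t₀ t₁))
    (hρsmooth : ContDiffOn ℝ (⊤ : ℕ∞) (fun p : ℝ × ℝ => ρ p.1 p.2)
      (Set.univ ×ˢ Set.Icc t₀ t₁))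
    (hrpos : ∀ θ : ℝ, ∀ t ∈ Set.Icc t₀ t₁, 0 < r θ t)
    (hρpos : ∀ θ : ℝ, ∀ t ∈ Set.Icc t₀ t₁, 0 < ρ θ t)
    (hrper : ∀ t ∈ Set.Icc t₀ t₁, Function.Periodic (fun θ => r θ t) (2 * π))
    (hρper : ∀ t ∈ Set.Icc t₀ t₁, Function.Periodic (fun θ => ρ θ t) (2 * π))
    (hgapf : RadialGAPF r (Set.Icc t₀ t₁))
    (hcsf : RadialCSF ρ (Set.Icc t₀ t₁))
    (hinit : ∀ θ : ℝ, r θ t₀ = ρ θ t₀) :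
    ∀ θ : ℝ, ∀ t ∈ Set.Icc t₀ t₁, ρ θ t ≤ r θ t := by
  rcases ht.eq_or_lt with rfl | h01
  · intro θ t htt
    obtain rfl : t = t₀ := le_antisymm htt.2 htt.1
    exact (hinit θ).ge
  have hr1 := contDiffOn_rdθ h01 hrsmooth
  have hρ1 := contDiffOn_rdθ h01 hρsmooth
  have hρ2 := contDiffOn_rdθ h01 hρ1
  have hpi : (0 : ℝ) < 2 * π := by positivity
  set Q : Set (ℝ × ℝ) := Set.Icc 0 (2 * π) ×ˢ Set.Icc t₀ t₁ with hQ
  have hQc : IsCompact Q := isCompact_Icc.prod isCompact_Icc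
  have hsub : Q ⊆ Set.univ ×ˢ Set.Icc t₀ t₁ := Set.prod_mono (Set.subset_univ _) subset_rfl
  have ca : ContinuousOn (fun p : ℝ × ℝ => r p.1 p.2) Q := hrsmooth.continuousOn.mono hsub
  have cb : ContinuousOn (fun p : ℝ × ℝ => ρ p.1 p.2) Q := hρsmooth.continuousOn.mono hsub
  have cp : ContinuousOn (fun p : ℝ × ℝ => rdθ ρ p.1 p.2) Q := hρ1.continuousOn.mono hsub
  have cq : ContinuousOn (fun p : ℝ × ℝ => rdθθ ρ p.1 p.2) Q := hρ2.continuousOn.mono hsub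
  let G : ℝ × ℝ → ℝ := fun z =>
    (rdθθ ρ z.1 z.2 * (r z.1 z.2 + ρ z.1 z.2) * (r z.1 z.2 * ρ z.1 z.2)
      - 2 * rdθ ρ z.1 z.2 ^ 2 * (r z.1 z.2 ^ 2 + r z.1 z.2 * ρ z.1 z.2 + ρ z.1 z.2 ^ 2
          + rdθ ρ z.1 z.2 ^ 2)
      + (rdθ ρ z.1 z.2 ^ 2 - r z.1 z.2 * ρ z.1 z.2) * (r z.1 z.2 * ρ z.1 z.2))
    / (r z.1 z.2 * ρ z.1 z.2 * (r z.1 z.2 ^ 2 + rdθ ρ z.1 z.2 ^ 2)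
        * (ρ z.1 z.2 ^ 2 + rdθ ρ z.1 z.2 ^ 2))
  have cG : ContinuousOn G Q := by
    apply ContinuousOn.div
    · fun_prop
    · fun_prop
    · rintro ⟨θ, t⟩ ⟨-, htt⟩
      have := hrpos θ t htt
      have := hρpos θ t htt
      dsimp only at *
      positivity
  obtain ⟨C, hC⟩ := hQc.exists_bound_of_continuousOn cG
  let φ : ℝ × ℝ → ℝ := fun z => Real.exp (-(C + 1) * z.2) * (r z.1 z.2 - ρ z.1 z.2)
  have cφ : ContinuousOn φ Q := by
    apply ContinuousOn.mul
    · fun_prop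
    · exact ca.sub cb
  obtain ⟨⟨θm, tm⟩, hmQ, hmin⟩ := hQc.exists_isMinOn
    ⟨(0, t₀), ⟨⟨le_rfl, hpi.le⟩, ⟨le_rfl, h01.le⟩⟩⟩ cφ
  have hglob : ∀ θ t, t ∈ Set.Icc t₀ t₁ → φ (θm, tm) ≤ φ (θ, t) := by
    intro θ t htt
    have hp : Function.Periodic (fun u => φ (u, t)) (2 * π) := by
      intro u
      have e1 := hrper t htt u
      have e2 := hρper t htt u
      simp only [φ] at e1 e2 ⊢
      rw [e1, e2]
    obtain ⟨y, hy, hye⟩ := hp.exists_mem_Ico₀ hpi θ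
    have := hmin (show (y, t) ∈ Q from ⟨⟨hy.1, hy.2.le⟩, htt⟩)
    simp only [Set.mem_ofPred_eq] at this hye
    rw [hye]
    exact this
  have htm : tm ∈ Set.Icc t₀ t₁ := hmQ.2
  suffices hkey : 0 ≤ r θm tm - ρ θm tm by
    intro θ t htt
    have h1 := hglob θ t htt
    have h2 : 0 ≤ φ (θm, tm) := mul_nonneg (Real.exp_pos _).le hkey
    have h3 : 0 ≤ Real.exp (-(C + 1) * t) * (r θ t - ρ θ t) := h2.trans h1
    have := nonneg_of_mul_nonneg_right h3 (Real.exp_pos _)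
    linarith
  by_contra! hneg
  have htm0 : t₀ < tm := by
    rcases htm.1.eq_or_lt with h | h
    · rw [← h, hinit] at hneg
      simp at hneg
    · exact h
  -- spatial information
  have hw1 : ∀ u, HasDerivAt (fun u => r u tm - ρ u tm) (rdθ r u tm - rdθ ρ u tm) u := fun u =>
    (hasDerivAt_rdθ hrsmooth u tm htm).sub (hasDerivAt_rdθ hρsmooth u tm htm)
  have hw2 : HasDerivAt (fun u => rdθ r u tm - rdθ ρ u tm)
      (rdθθ r θm tm - rdθθ ρ θm tm) θm :=
    (hasDerivAt_rdθ hr1 θm tm htm).sub (hasDerivAt_rdθ hρ1 θm tm htm)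
  have hwmin : IsLocalMin (fun u => r u tm - ρ u tm) θm := by
    refine Filter.Eventually.of_forall fun u => ?_
    exact le_of_mul_le_mul_left (hglob u tm htm) (Real.exp_pos _)
  have hp0 : rdθ r θm tm = rdθ ρ θm tm := by
    have := hwmin.hasDerivAt_eq_zero (hw1 θm)
    linarith
  have hq0 : 0 ≤ rdθθ r θm tm - rdθθ ρ θm tm := second_deriv_nonneg_of_min hw1 hw2 hwmin
  -- time information
  have hd := (hgapf tm htm θm).sub (hcsf tm htm θm)
  have he : HasDerivWithinAt (fun s : ℝ => Real.exp (-(C + 1) * s))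
      (Real.exp (-(C + 1) * tm) * (-(C + 1))) (Set.Icc t₀ t₁) tm := by
    have := ((hasDerivAt_id tm).const_mul (-(C + 1))).exp
    simpa using this.hasDerivWithinAt
  have ht' := left_deriv_nonpos_of_min htm0 htm.2 (he.mul hd)
    (fun s hs => hglob θm s hs)
  have ha := hrpos θm tm htm
  have hb := hρpos θm tm htm
  have hL : 0 ≤ rlen r tm :=
    intervalIntegral.integral_nonneg hpi.le fun u _ => Real.sqrt_nonneg _
  have hF : 0 ≤ 2 * π * rmet r θm tm / (r θm tm * rlen r tm) := by
    have : 0 ≤ rmet r θm tm := Real.sqrt_nonneg _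
    positivity
  have hGm := (abs_le.1 (hC (θm, tm) hmQ)).1
  have hid := csf_diff_identity (r θm tm) (ρ θm tm) (rdθ ρ θm tm) (rdθθ ρ θm tm) ha hb
  change _ = (ρ θm tm - r θm tm) * G (θm, tm) at hid
  simp only [rmet_sq, hp0, Pi.sub_apply] at ht'
  generalize 2 * π * rmet r θm tm / (r θm tm * rlen r tm) = Fo at hF ht'
  have hqq : rdθθ ρ θm tm / (r θm tm ^ 2 + rdθ ρ θm tm ^ 2)
      ≤ rdθθ r θm tm / (r θm tm ^ 2 + rdθ ρ θm tm ^ 2) := by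
    gcongr
    linarith
  have hGb : (ρ θm tm - r θm tm) * (-C) ≤ (ρ θm tm - r θm tm) * G (θm, tm) :=
    mul_le_mul_of_nonneg_left hGm (by linarith)
  rw [mul_assoc, ← mul_add] at ht'
  have ht2 := nonpos_of_mul_nonpos_right ht' (Real.exp_pos _)
  nlinarith
end
end

section
/- Let X(·,t), t ∈ [0,T], be a smooth solution of Gage's area-preserving flow with evolving length L(t) and constant enclosed area A₀, and let h > 0 be a constant such that the support function p = −⟨X, N⟩ satisfies p(s,t) ≥ 2h for all points and all t ∈ [0,T]. Then the curvature satisfies, for all (s,t): κ/(p − h) ≤ max{ max_s κ(s,0)/(p(s,0) − h), 2/h² } and κ/(p − h) ≥ min{ min_s κ(s,0)/(p(s,0) − h), −2π/(√(4πA₀) h) }. In particular, since h ≤ p ≤ L(0)/2, the curvature is bounded above by (L(0)/2 − h)·max{ max_s κ(s,0)/(p(s,0) − h), 2/h² } and below by (L(0)/2 − h)·min{ min_s κ(s,0)/(p(s,0) − h), −2π/(√(4πA₀) h) } on [0,T]. -/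
open Real Set MeasureTheory Filter

noncomputable section

/-- Euclidean norm of a plane vector. -/
def vnorm (v : ℝ × ℝ) : ℝ := Real.sqrt (v.1 ^ 2 + v.2 ^ 2)

/-- Determinant of the 2×2 matrix whose rows are the plane vectors `a`, `b`. -/
def vdet (a b : ℝ × ℝ) : ℝ := a.1 * b.2 - a.2 * b.1

/-- Unit tangent vector of a plane curve. -/
def unitTangent (X : ℝ → ℝ × ℝ) (φ : ℝ) : ℝ × ℝ :=
  (vnorm (deriv X φ))⁻¹ • deriv X φ

/-- Inward unit normal: the rotation of the unit tangent by +π/2. -/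
def innerNormal (X : ℝ → ℝ × ℝ) (φ : ℝ) : ℝ × ℝ :=
  (-(unitTangent X φ).2, (unitTangent X φ).1)

/-- Curvature of a plane curve. -/
def curv (X : ℝ → ℝ × ℝ) (φ : ℝ) : ℝ :=
  vdet (deriv X φ) (deriv (deriv X) φ) / vnorm (deriv X φ) ^ 3

/-- Length of a closed plane curve parametrized on `[0, 2π]`. -/
def clen (X : ℝ → ℝ × ℝ) : ℝ := ∫ φ in (0:ℝ)..(2 * π), vnorm (deriv X φ)

/-- Enclosed area of a closed plane curve. -/
def carea (X : ℝ → ℝ × ℝ) : ℝ :=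
  (1 / 2) * ∫ φ in (0:ℝ)..(2 * π), vdet (X φ) (deriv X φ)

/-- A smooth closed plane curve: a smooth `2π`-periodic map `ℝ → ℝ²` with
nonvanishing derivative. -/
structure IsSmoothClosedCurve (X : ℝ → ℝ × ℝ) : Prop where
  smooth : ContDiff ℝ (⊤ : ℕ∞) X
  periodic : Function.Periodic X (2 * π)
  regular : ∀ φ, deriv X φ ≠ 0

/-- An embedded closed curve: injective over one period. -/
def IsEmbeddedCurve (X : ℝ → ℝ × ℝ) : Prop := Set.InjOn X (Set.Ico 0 (2 * π))

/-- Star-shapedness with respect to a point `O`: `det(X − O, T) > 0` everywhere. -/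
def StarShapedWrt (X : ℝ → ℝ × ℝ) (O : ℝ × ℝ) : Prop :=
  ∀ φ, 0 < vdet (X φ - O) (unitTangent X φ)

/-- Centrosymmetry with respect to a point `O`: the image of the curve is invariant
under the point reflection `Z ↦ 2O − Z`. -/
def CentroSymmetricWrt (X : ℝ → ℝ × ℝ) (O : ℝ × ℝ) : Prop :=
  (fun Z => (2 : ℝ) • O - Z) '' Set.range X = Set.range X

/-- `X` is a smooth solution of Gage's area-preserving flow on the time set `I`
with initial curve `X₀`: `∂X/∂t = α T + (κ − 2π/L) N`. -/
structure IsGAPFSolutionOn (X : ℝ → ℝ → ℝ × ℝ) (X₀ : ℝ → ℝ × ℝ) (I : Set ℝ) : Prop where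
  init : ∀ φ, X 0 φ = X₀ φ
  curve : ∀ t ∈ I, IsSmoothClosedCurve (X t)
  smooth : ContDiffOn ℝ (⊤ : ℕ∞) (fun p : ℝ × ℝ => X p.1 p.2) (I ×ˢ Set.univ)
  flow : ∃ α : ℝ → ℝ → ℝ,
    ∀ t ∈ I, ∀ φ,
      HasDerivWithinAt (fun τ => X τ φ)
        (α t φ • unitTangent (X t) φ +
          (curv (X t) φ - 2 * π / clen (X t)) • innerNormal (X t) φ) I t

/-- The support function `p = −⟨X, N⟩ = det(X, T)` of the evolving curve. -/
def suppFn (X : ℝ → ℝ → ℝ × ℝ) (t φ : ℝ) : ℝ := vdet (X t φ) (unitTangent (X t) φ)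

/-- The quantity `φ₄ = κ/(p − h)`. -/
def phi4 (X : ℝ → ℝ → ℝ × ℝ) (h t φ : ℝ) : ℝ := curv (X t) φ / (suppFn X t φ - h)

/-- The maximum of `φ₄(·, 0)` over one period. -/
def phi4Max (X : ℝ → ℝ → ℝ × ℝ) (h : ℝ) : ℝ :=
  sSup ((fun φ => phi4 X h 0 φ) '' Set.Icc (0:ℝ) (2 * π))

/-- The minimum of `φ₄(·, 0)` over one period. -/
def phi4Min (X : ℝ → ℝ → ℝ × ℝ) (h : ℝ) : ℝ :=
  sInf ((fun φ => phi4 X h 0 φ) '' Set.Icc (0:ℝ) (2 * π))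

open scoped ContDiff

/-! ### Smooth functions of time and space -/

/-- Derivative in the space variable. -/
def dS (f : ℝ → ℝ → ℝ) (t φ : ℝ) : ℝ := deriv (f t) φ

/-- Derivative in the time variable. -/
def dT (f : ℝ → ℝ → ℝ) (t φ : ℝ) : ℝ := deriv (fun τ => f τ φ) t

/-- Joint smoothness on `J × ℝ`. -/
def Sm (J : Set ℝ) (f : ℝ → ℝ → ℝ) : Prop :=
  ContDiffOn ℝ ∞ (fun q : ℝ × ℝ => f q.1 q.2) (J ×ˢ (Set.univ : Set ℝ))

lemma Sm.mono {J K : Set ℝ} {f : ℝ → ℝ → ℝ} (hf : Sm J f) (h : K ⊆ J) : Sm K f :=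
  ContDiffOn.mono hf (Set.prod_mono h subset_rfl)

lemma Sm.congr {J : Set ℝ} {f g : ℝ → ℝ → ℝ} (hf : Sm J f)
    (h : ∀ t ∈ J, ∀ φ, g t φ = f t φ) : Sm J g :=
  ContDiffOn.congr hf (fun q hq => h q.1 hq.1 q.2)

lemma Sm.add {J : Set ℝ} {f g : ℝ → ℝ → ℝ} (hf : Sm J f) (hg : Sm J g) :
    Sm J (fun t φ => f t φ + g t φ) := ContDiffOn.add hf hg

lemma Sm.sub {J : Set ℝ} {f g : ℝ → ℝ → ℝ} (hf : Sm J f) (hg : Sm J g) :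
    Sm J (fun t φ => f t φ - g t φ) := ContDiffOn.sub hf hg

lemma Sm.mul {J : Set ℝ} {f g : ℝ → ℝ → ℝ} (hf : Sm J f) (hg : Sm J g) :
    Sm J (fun t φ => f t φ * g t φ) := ContDiffOn.mul hf hg

lemma Sm.pow {J : Set ℝ} {f : ℝ → ℝ → ℝ} (hf : Sm J f) (n : ℕ) :
    Sm J (fun t φ => f t φ ^ n) := ContDiffOn.pow hf n

lemma Sm.div {J : Set ℝ} {f g : ℝ → ℝ → ℝ} (hf : Sm J f) (hg : Sm J g)
    (h : ∀ t ∈ J, ∀ φ, g t φ ≠ 0) :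
    Sm J (fun t φ => f t φ / g t φ) := ContDiffOn.div hf hg (fun q hq => h q.1 hq.1 q.2)

lemma Sm.sqrt {J : Set ℝ} {f : ℝ → ℝ → ℝ} (hf : Sm J f)
    (h : ∀ t ∈ J, ∀ φ, f t φ ≠ 0) :
    Sm J (fun t φ => Real.sqrt (f t φ)) := ContDiffOn.sqrt hf (fun q hq => h q.1 hq.1 q.2)

lemma Sm.const {J : Set ℝ} (c : ℝ) : Sm J (fun _ _ => c) := contDiffOn_const

lemma Sm.hasS_aux {J : Set ℝ} {f : ℝ → ℝ → ℝ} (hf : Sm J f) {t : ℝ} (ht : t ∈ J) (φ : ℝ) :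
    HasDerivAt (f t) (fderivWithin ℝ (fun q : ℝ × ℝ => f q.1 q.2)
      (J ×ˢ (Set.univ : Set ℝ)) (t, φ) (0, 1)) φ := by
  have h1 : HasFDerivWithinAt (fun q : ℝ × ℝ => f q.1 q.2) _ (J ×ˢ (Set.univ : Set ℝ)) (t, φ) :=
    ((hf.differentiableOn (by simp)) (t, φ) ⟨ht, trivial⟩).hasFDerivWithinAt
  have h2 : HasDerivWithinAt (fun s : ℝ => ((t, s) : ℝ × ℝ)) (0, 1) Set.univ φ :=
    ((hasDerivAt_const φ t).prodMk (hasDerivAt_id φ)).hasDerivWithinAt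
  have h3 := h1.comp_hasDerivWithinAt φ h2 (fun s _ => ⟨ht, trivial⟩)
  rw [hasDerivWithinAt_univ] at h3
  exact h3

lemma Sm.hasS {J : Set ℝ} {f : ℝ → ℝ → ℝ} (hf : Sm J f) {t : ℝ} (ht : t ∈ J) (φ : ℝ) :
    HasDerivAt (f t) (dS f t φ) φ := (hf.hasS_aux ht φ).differentiableAt.hasDerivAt

lemma Sm.dS {J : Set ℝ} {f : ℝ → ℝ → ℝ} (hJ : UniqueDiffOn ℝ J) (hf : Sm J f) :
    Sm J (dS f) := by
  have h1 := ContDiffOn.fderivWithin (m := ∞) hf (hJ.prod uniqueDiffOn_univ) (by simp)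
  have h2 := h1.clm_apply (contDiffOn_const (c := ((0, 1) : ℝ × ℝ)))
  exact h2.congr (fun q hq => (hf.hasS_aux hq.1 q.2).deriv)

lemma Sm.contDiffAt {J : Set ℝ} (hJ : IsOpen J) {f : ℝ → ℝ → ℝ} (hf : Sm J f) {t : ℝ}
    (ht : t ∈ J) (φ : ℝ) : ContDiffAt ℝ ∞ (fun q : ℝ × ℝ => f q.1 q.2) (t, φ) :=
  ContDiffOn.contDiffAt hf ((hJ.prod isOpen_univ).mem_nhds ⟨ht, trivial⟩)

lemma Sm.hasT_aux {J : Set ℝ} (hJ : IsOpen J) {f : ℝ → ℝ → ℝ} (hf : Sm J f) {t : ℝ}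
    (ht : t ∈ J) (φ : ℝ) :
    HasDerivAt (fun τ => f τ φ) (fderiv ℝ (fun q : ℝ × ℝ => f q.1 q.2) (t, φ) (1, 0)) t := by
  have h1 := ((hf.contDiffAt hJ ht φ).differentiableAt (by simp)).hasFDerivAt
  have h2 : HasDerivAt (fun s : ℝ => ((s, φ) : ℝ × ℝ)) (1, 0) t :=
    (hasDerivAt_id t).prodMk (hasDerivAt_const t φ)
  exact h1.comp_hasDerivAt t h2

lemma Sm.hasS_aux' {J : Set ℝ} (hJ : IsOpen J) {f : ℝ → ℝ → ℝ} (hf : Sm J f) {t : ℝ}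
    (ht : t ∈ J) (φ : ℝ) :
    HasDerivAt (f t) (fderiv ℝ (fun q : ℝ × ℝ => f q.1 q.2) (t, φ) (0, 1)) φ := by
  have := hf.hasS_aux ht φ
  rwa [fderivWithin_of_isOpen (hJ.prod isOpen_univ) ⟨ht, trivial⟩] at this

lemma Sm.hasT {J : Set ℝ} (hJ : IsOpen J) {f : ℝ → ℝ → ℝ} (hf : Sm J f) {t : ℝ}
    (ht : t ∈ J) (φ : ℝ) : HasDerivAt (fun τ => f τ φ) (dT f t φ) t :=
  (hf.hasT_aux hJ ht φ).differentiableAt.hasDerivAt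

lemma Sm.dT {J : Set ℝ} (hJ : IsOpen J) {f : ℝ → ℝ → ℝ} (hf : Sm J f) :
    Sm J (dT f) := by
  have h1 := ContDiffOn.fderiv_of_isOpen (m := ∞) hf (hJ.prod isOpen_univ) (by simp)
  have h2 := h1.clm_apply (contDiffOn_const (c := ((1, 0) : ℝ × ℝ)))
  exact h2.congr (fun q hq => (hf.hasT_aux hJ hq.1 q.2).deriv)

/-- Mixed partial derivatives commute. -/
lemma Sm.comm {J : Set ℝ} (hJ : IsOpen J) {f : ℝ → ℝ → ℝ} (hf : Sm J f) {t : ℝ}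
    (ht : t ∈ J) (φ : ℝ) : _root_.dT (_root_.dS f) t φ = _root_.dS (_root_.dT f) t φ := by
  have hs : IsOpen (J ×ˢ (Set.univ : Set ℝ)) := hJ.prod isOpen_univ
  have hsym := (hf.contDiffAt hJ ht φ).isSymmSndFDerivAt (by
    simp only [minSmoothness_of_isRCLikeNormedField]; rw [← one_add_one_eq_two]; norm_cast)
  have hD : DifferentiableAt ℝ (fderiv ℝ (fun q : ℝ × ℝ => f q.1 q.2)) (t, φ) :=
    ((hf.contDiffAt hJ ht φ).fderiv_right (m := 1) (by
      norm_cast)).differentiableAt (by simp)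
  have key : ∀ c : ℝ × ℝ, HasFDerivAt (fun q => fderiv ℝ (fun q : ℝ × ℝ => f q.1 q.2) q c)
      ((fderiv ℝ (fderiv ℝ (fun q : ℝ × ℝ => f q.1 q.2)) (t, φ)).flip c) (t, φ) := by
    intro c
    have := hD.hasFDerivAt.clm_apply (hasFDerivAt_const c (t, φ))
    simpa using this
  have hmem : J ×ˢ (Set.univ : Set ℝ) ∈ nhds (t, φ) := hs.mem_nhds ⟨ht, trivial⟩
  have hJS := hf.dS hJ.uniqueDiffOn
  have hJT := hf.dT hJ
  have e1 := (hJS.hasT_aux hJ ht φ).deriv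
  have e2 := (hJT.hasS_aux' hJ ht φ).deriv
  have e3 : fderiv ℝ (fun q : ℝ × ℝ => _root_.dS f q.1 q.2) (t, φ) = _ :=
    ((key (0, 1)).congr_of_eventuallyEq (by
      filter_upwards [hmem] with q hq
      exact (hf.hasS_aux' hJ hq.1 q.2).deriv)).fderiv
  have e4 : fderiv ℝ (fun q : ℝ × ℝ => _root_.dT f q.1 q.2) (t, φ) = _ :=
    ((key (1, 0)).congr_of_eventuallyEq (by
      filter_upwards [hmem] with q hq
      exact (hf.hasT_aux hJ hq.1 q.2).deriv)).fderiv
  rw [e3] at e1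
  rw [e4] at e2
  calc _root_.dT (_root_.dS f) t φ = _ := e1
    _ = _ := hsym (1, 0) (0, 1)
    _ = _ := e2.symm

/-! ### Geometry in coordinates -/

/-- Speed. -/
def gV (x y : ℝ → ℝ → ℝ) (t φ : ℝ) : ℝ := Real.sqrt (dS x t φ ^ 2 + dS y t φ ^ 2)
/-- First coordinate of the unit tangent. -/
def gA (x y : ℝ → ℝ → ℝ) (t φ : ℝ) : ℝ := dS x t φ / gV x y t φ
/-- Second coordinate of the unit tangent. -/
def gB (x y : ℝ → ℝ → ℝ) (t φ : ℝ) : ℝ := dS y t φ / gV x y t φ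
/-- Curvature. -/
def gK (x y : ℝ → ℝ → ℝ) (t φ : ℝ) : ℝ :=
  (dS x t φ * dS (dS y) t φ - dS y t φ * dS (dS x) t φ) / gV x y t φ ^ 3
/-- Support function. -/
def gP (x y : ℝ → ℝ → ℝ) (t φ : ℝ) : ℝ := x t φ * gB x y t φ - y t φ * gA x y t φ
/-- Tangential part of the position. -/
def gQ (x y : ℝ → ℝ → ℝ) (t φ : ℝ) : ℝ := x t φ * gA x y t φ + y t φ * gB x y t φ

/-- A smooth family of regular curves, in coordinates. -/
structure Geo (J : Set ℝ) (x y : ℝ → ℝ → ℝ) : Prop where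
  uniq : UniqueDiffOn ℝ J
  hx : Sm J x
  hy : Sm J y
  reg : ∀ t ∈ J, ∀ φ, 0 < dS x t φ ^ 2 + dS y t φ ^ 2

namespace Geo

variable {J : Set ℝ} {x y : ℝ → ℝ → ℝ}

lemma smx (g : Geo J x y) : Sm J (dS x) := g.hx.dS g.uniq
lemma smy (g : Geo J x y) : Sm J (dS y) := g.hy.dS g.uniq

lemma vpos (g : Geo J x y) {t : ℝ} (ht : t ∈ J) (φ : ℝ) : 0 < gV x y t φ :=
  Real.sqrt_pos.2 (g.reg t ht φ)

lemma smV (g : Geo J x y) : Sm J (gV x y) :=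
  ((g.smx.pow 2).add (g.smy.pow 2)).sqrt (fun t ht φ => (g.reg t ht φ).ne')

lemma smA (g : Geo J x y) : Sm J (gA x y) := g.smx.div g.smV (fun _ ht φ => (g.vpos ht φ).ne')
lemma smB (g : Geo J x y) : Sm J (gB x y) := g.smy.div g.smV (fun _ ht φ => (g.vpos ht φ).ne')

lemma smK (g : Geo J x y) : Sm J (gK x y) :=
  ((g.smx.mul (g.smy.dS g.uniq)).sub (g.smy.mul (g.smx.dS g.uniq))).div (g.smV.pow 3)
    (fun _ ht φ => (pow_pos (g.vpos ht φ) 3).ne')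

lemma smP (g : Geo J x y) : Sm J (gP x y) := (g.hx.mul g.smB).sub (g.hy.mul g.smA)
lemma smQ (g : Geo J x y) : Sm J (gQ x y) := (g.hx.mul g.smA).add (g.hy.mul g.smB)

lemma vsq (g : Geo J x y) {t : ℝ} (ht : t ∈ J) (φ : ℝ) :
    gV x y t φ ^ 2 = dS x t φ ^ 2 + dS y t φ ^ 2 := Real.sq_sqrt (g.reg t ht φ).le

lemma dSx (g : Geo J x y) {t : ℝ} (ht : t ∈ J) (φ : ℝ) :
    dS x t φ = gV x y t φ * gA x y t φ := by
  have := (g.vpos ht φ).ne'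
  simp only [gA]; field_simp

lemma dSy (g : Geo J x y) {t : ℝ} (ht : t ∈ J) (φ : ℝ) :
    dS y t φ = gV x y t φ * gB x y t φ := by
  have := (g.vpos ht φ).ne'
  simp only [gB]; field_simp

lemma unit (g : Geo J x y) {t : ℝ} (ht : t ∈ J) (φ : ℝ) :
    gA x y t φ ^ 2 + gB x y t φ ^ 2 = 1 := by
  have h := (g.vpos ht φ).ne'
  simp only [gA, gB]
  rw [div_pow, div_pow, ← add_div, ← g.vsq ht φ]
  field_simp

lemma dSV (g : Geo J x y) {t : ℝ} (ht : t ∈ J) (φ : ℝ) :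
    gV x y t φ * dS (gV x y) t φ = dS x t φ * dS (dS x) t φ + dS y t φ * dS (dS y) t φ := by
  have h1 := (g.smV.hasS ht φ).pow 2
  have h2 := ((g.smx.hasS ht φ).pow 2).add ((g.smy.hasS ht φ).pow 2)
  have h3 : (gV x y t) ^ 2 = dS x t ^ 2 + dS y t ^ 2 := by
    funext s; simpa using g.vsq ht s
  rw [h3] at h1
  have := h1.unique h2
  norm_num at this
  linarith

lemma dSA (g : Geo J x y) {t : ℝ} (ht : t ∈ J) (φ : ℝ) :
    dS (gA x y) t φ = -(gV x y t φ * gK x y t φ * gB x y t φ) := by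
  have hv := (g.vpos ht φ).ne'
  have h1 := (g.smx.hasS ht φ).div (g.smV.hasS ht φ) hv
  have h2 : dS (gA x y) t φ = _ := h1.deriv
  rw [h2]
  have h3 := g.dSV ht φ
  have h4 := g.vsq ht φ
  simp only [gK, gB]
  field_simp
  linear_combination (dS (dS x) t φ) * h4 - dS x t φ * h3

lemma dSB (g : Geo J x y) {t : ℝ} (ht : t ∈ J) (φ : ℝ) :
    dS (gB x y) t φ = gV x y t φ * gK x y t φ * gA x y t φ := by
  have hv := (g.vpos ht φ).ne'
  have h1 := (g.smy.hasS ht φ).div (g.smV.hasS ht φ) hv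
  have h2 : dS (gB x y) t φ = _ := h1.deriv
  rw [h2]
  have h3 := g.dSV ht φ
  have h4 := g.vsq ht φ
  simp only [gK, gA]
  field_simp
  linear_combination (dS (dS y) t φ) * h4 - dS y t φ * h3

lemma dSP (g : Geo J x y) {t : ℝ} (ht : t ∈ J) (φ : ℝ) :
    dS (gP x y) t φ = gV x y t φ * gK x y t φ * gQ x y t φ := by
  have h1 := ((g.hx.hasS ht φ).mul (g.smB.hasS ht φ)).sub
    ((g.hy.hasS ht φ).mul (g.smA.hasS ht φ))
  have h2 : dS (gP x y) t φ = _ := h1.deriv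
  rw [h2, g.dSA ht, g.dSB ht, g.dSx ht, g.dSy ht]
  simp only [gQ]; ring

lemma dSQ (g : Geo J x y) {t : ℝ} (ht : t ∈ J) (φ : ℝ) :
    dS (gQ x y) t φ = gV x y t φ - gV x y t φ * gK x y t φ * gP x y t φ := by
  have h1 := ((g.hx.hasS ht φ).mul (g.smA.hasS ht φ)).add
    ((g.hy.hasS ht φ).mul (g.smB.hasS ht φ))
  have h2 : dS (gQ x y) t φ = _ := h1.deriv
  rw [h2, g.dSA ht, g.dSB ht, g.dSx ht, g.dSy ht]
  simp only [gP]
  linear_combination (gV x y t φ) * g.unit ht φ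

lemma dSSP (g : Geo J x y) {t : ℝ} (ht : t ∈ J) (φ : ℝ) :
    dS (dS (gP x y)) t φ = (dS (gV x y) t φ * gK x y t φ + gV x y t φ * dS (gK x y) t φ)
        * gQ x y t φ
      + gV x y t φ * gK x y t φ * (gV x y t φ - gV x y t φ * gK x y t φ * gP x y t φ) := by
  have h1 := ((g.smV.hasS ht φ).mul (g.smK.hasS ht φ)).mul (g.smQ.hasS ht φ)
  have h2 : dS (gP x y) t = gV x y t * gK x y t * gQ x y t := by
    funext s; simpa using g.dSP ht s
  rw [← h2] at h1
  have h3 : dS (dS (gP x y)) t φ = _ := h1.deriv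
  rw [h3, g.dSQ ht]
  simp

/-- The flow equation in coordinates. -/
def Flow (J : Set ℝ) (x y α : ℝ → ℝ → ℝ) (b : ℝ → ℝ) : Prop :=
  ∀ t ∈ J, ∀ φ, dT x t φ = α t φ * gA x y t φ - (gK x y t φ - b t) * gB x y t φ ∧
    dT y t φ = α t φ * gB x y t φ + (gK x y t φ - b t) * gA x y t φ

variable {α : ℝ → ℝ → ℝ} {b : ℝ → ℝ}

lemma alpha_eq (g : Geo J x y) (fl : Flow J x y α b) {t : ℝ} (ht : t ∈ J) (φ : ℝ) :
    α t φ = dT x t φ * gA x y t φ + dT y t φ * gB x y t φ := by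
  rw [(fl t ht φ).1, (fl t ht φ).2]
  linear_combination (-(α t φ)) * g.unit ht φ

lemma smAl (hJ : IsOpen J) (g : Geo J x y) (fl : Flow J x y α b) : Sm J α :=
  (((g.hx.dT hJ).mul g.smA).add ((g.hy.dT hJ).mul g.smB)).congr
    (fun _ ht φ => g.alpha_eq fl ht φ)

/-- Derivative of the velocity. -/
lemma velS (hJ : IsOpen J) (g : Geo J x y) (fl : Flow J x y α b) {t : ℝ} (ht : t ∈ J) (φ : ℝ) :
    dS (dT x) t φ = dS α t φ * gA x y t φ - α t φ * (gV x y t φ * gK x y t φ * gB x y t φ)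
      - dS (gK x y) t φ * gB x y t φ
      - (gK x y t φ - b t) * (gV x y t φ * gK x y t φ * gA x y t φ) ∧
    dS (dT y) t φ = dS α t φ * gB x y t φ + α t φ * (gV x y t φ * gK x y t φ * gA x y t φ)
      + dS (gK x y) t φ * gA x y t φ
      - (gK x y t φ - b t) * (gV x y t φ * gK x y t φ * gB x y t φ) := by
  have ha := (smAl hJ g fl).hasS ht φ
  have hA := g.smA.hasS ht φ
  have hB := g.smB.hasS ht φ
  have hK := (g.smK.hasS ht φ).sub_const (b t)
  constructor
  · have h1 := (ha.mul hA).sub (hK.mul hB)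
    have h2 : dT x t = (α t * gA x y t - (fun s => gK x y t s - b t) * gB x y t) := by
      funext s; simpa using (fl t ht s).1
    rw [← h2] at h1
    have h3 : dS (dT x) t φ = _ := h1.deriv
    rw [h3, g.dSA ht, g.dSB ht]; ring
  · have h1 := (ha.mul hB).add (hK.mul hA)
    have h2 : dT y t = (α t * gB x y t + (fun s => gK x y t s - b t) * gA x y t) := by
      funext s; simpa using (fl t ht s).2
    rw [← h2] at h1
    have h3 : dS (dT y) t φ = _ := h1.deriv
    rw [h3, g.dSA ht, g.dSB ht]; ring

lemma dT_congr (hJ : IsOpen J) {f k : ℝ → ℝ → ℝ} {t : ℝ} (ht : t ∈ J) (φ : ℝ)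
    (h : ∀ τ ∈ J, f τ φ = k τ φ) : dT f t φ = dT k t φ := by
  apply Filter.EventuallyEq.deriv_eq
  filter_upwards [hJ.mem_nhds ht] with τ hτ using h τ hτ

/-- Time derivatives of speed and unit tangent. -/
lemma evol1 (hJ : IsOpen J) (g : Geo J x y) (fl : Flow J x y α b) {t : ℝ} (ht : t ∈ J) (φ : ℝ) :
    dT (gV x y) t φ = dS α t φ - (gK x y t φ - b t) * gV x y t φ * gK x y t φ ∧
    dT (gA x y) t φ = -((α t φ * gK x y t φ + dS (gK x y) t φ / gV x y t φ) * gB x y t φ) ∧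
    dT (gB x y) t φ = (α t φ * gK x y t φ + dS (gK x y) t φ / gV x y t φ) * gA x y t φ := by
  have hv := (g.vpos ht φ).ne'
  have hA := g.smA.hasT hJ ht φ
  have hB := g.smB.hasT hJ ht φ
  have hV := g.smV.hasT hJ ht φ
  have e1 : dT (dS x) t φ = dT (gV x y) t φ * gA x y t φ + gV x y t φ * dT (gA x y) t φ := by
    rw [dT_congr (k := fun t φ => gV x y t φ * gA x y t φ) hJ ht φ (fun τ hτ => g.dSx hτ φ)]
    exact (hV.mul hA).deriv
  have e2 : dT (dS y) t φ = dT (gV x y) t φ * gB x y t φ + gV x y t φ * dT (gB x y) t φ := by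
    rw [dT_congr (k := fun t φ => gV x y t φ * gB x y t φ) hJ ht φ (fun τ hτ => g.dSy hτ φ)]
    exact (hV.mul hB).deriv
  have e3 : gA x y t φ * dT (gA x y) t φ + gB x y t φ * dT (gB x y) t φ = 0 := by
    have h1 := ((hA.pow 2).add (hB.pow 2)).deriv
    have h2 := dT_congr (f := fun t φ => gA x y t φ ^ 2 + gB x y t φ ^ 2) (k := fun _ _ => 1)
      hJ ht φ (fun τ hτ => g.unit hτ φ)
    have h3 : dT (fun t φ => gA x y t φ ^ 2 + gB x y t φ ^ 2) t φ = _ := h1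
    rw [h3] at h2
    simp [dT] at h2
    simp only [dT]
    linarith
  rw [g.hx.comm hJ ht, (velS hJ g fl ht φ).1] at e1
  rw [g.hy.comm hJ ht, (velS hJ g fl ht φ).2] at e2
  have u := g.unit ht φ
  generalize dT (gV x y) t φ = vt at *
  generalize dT (gA x y) t φ = att at *
  generalize dT (gB x y) t φ = bt at *
  generalize gA x y t φ = A at *
  generalize gB x y t φ = B at *
  generalize gV x y t φ = v at *
  generalize gK x y t φ = k at *
  generalize dS (gK x y) t φ = k1 at *
  generalize dS α t φ = a1 at *
  generalize α t φ = a at *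
  have hvt : vt = a1 - (k - b t) * v * k := by
    linear_combination (-A) * e1 - B * e2 + (a1 - (k - b t) * v * k - vt) * u - v * e3
  subst hvt
  refine ⟨rfl, ?_, ?_⟩
  · field_simp
    linear_combination (-1) * e1
  · field_simp
    linear_combination (-1) * e2

lemma evolP (hJ : IsOpen J) (g : Geo J x y) (fl : Flow J x y α b) {t : ℝ} (ht : t ∈ J) (φ : ℝ) :
    dT (gP x y) t φ = -(gK x y t φ - b t) +
      (α t φ * gK x y t φ + dS (gK x y) t φ / gV x y t φ) * gQ x y t φ := by
  have h1 := ((g.hx.hasT hJ ht φ).mul (g.smB.hasT hJ ht φ)).sub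
    ((g.hy.hasT hJ ht φ).mul (g.smA.hasT hJ ht φ))
  have h2 : dT (gP x y) t φ = _ := h1.deriv
  obtain ⟨-, e2, e3⟩ := evol1 hJ g fl ht φ
  rw [h2, e2, e3, (fl t ht φ).1, (fl t ht φ).2]
  simp only [gQ]
  linear_combination (-(gK x y t φ - b t)) * g.unit ht φ

lemma evolK (hJ : IsOpen J) (g : Geo J x y) (fl : Flow J x y α b) {t : ℝ} (ht : t ∈ J) (φ : ℝ) :
    dT (gK x y) t φ = α t φ * dS (gK x y) t φ / gV x y t φ
      + (dS (dS (gK x y)) t φ * gV x y t φ - dS (gK x y) t φ * dS (gV x y) t φ) / gV x y t φ ^ 3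
      + (gK x y t φ - b t) * gK x y t φ ^ 2 := by
  have hv := (g.vpos ht φ).ne'
  have hA := g.smA.hasT hJ ht φ
  have hB := g.smB.hasT hJ ht φ
  have hV := g.smV.hasT hJ ht φ
  have hK := g.smK.hasT hJ ht φ
  have hK1 := (g.smK.dS g.uniq).hasS ht φ
  have hW := ((smAl hJ g fl).hasS ht φ |>.mul (g.smK.hasS ht φ)).add
    (hK1.div (g.smV.hasS ht φ) hv)
  obtain ⟨e1, e2, e3⟩ := evol1 hJ g fl ht φ
  have a1 : dT (dS (gA x y)) t φ = -((dT (gV x y) t φ * gK x y t φ + gV x y t φ * dT (gK x y) t φ)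
      * gB x y t φ + gV x y t φ * gK x y t φ * dT (gB x y) t φ) := by
    rw [dT_congr (k := fun t φ => -(gV x y t φ * gK x y t φ * gB x y t φ)) hJ ht φ
      (fun τ hτ => g.dSA hτ φ)]
    exact ((hV.mul hK).mul hB).neg.deriv
  have a2 : dT (dS (gB x y)) t φ = (dT (gV x y) t φ * gK x y t φ + gV x y t φ * dT (gK x y) t φ)
      * gA x y t φ + gV x y t φ * gK x y t φ * dT (gA x y) t φ := by
    rw [dT_congr (k := fun t φ => gV x y t φ * gK x y t φ * gA x y t φ) hJ ht φ
      (fun τ hτ => g.dSB hτ φ)]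
    exact ((hV.mul hK).mul hA).deriv
  have f1 : dT (gA x y) t = -((α t * gK x y t + dS (gK x y) t / gV x y t) * gB x y t) := by
    funext s; simpa using (evol1 hJ g fl ht s).2.1
  have f2 : dT (gB x y) t = (α t * gK x y t + dS (gK x y) t / gV x y t) * gA x y t := by
    funext s; simpa using (evol1 hJ g fl ht s).2.2
  have w1 := (hW.mul (g.smB.hasS ht φ)).neg
  have w2 := hW.mul (g.smA.hasS ht φ)
  rw [← f1] at w1
  rw [← f2] at w2
  have b1 : dS (dT (gA x y)) t φ = _ := w1.deriv
  have b2 : dS (dT (gB x y)) t φ = _ := w2.deriv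
  rw [← g.smA.comm hJ ht, a1, g.dSB ht, e1, e3] at b1
  rw [← g.smB.comm hJ ht, a2, g.dSA ht, e1, e2] at b2
  simp only [Pi.add_apply, Pi.mul_apply, Pi.div_apply] at b1 b2
  have u := g.unit ht φ
  generalize dT (gK x y) t φ = kt at *
  generalize gA x y t φ = A at *
  generalize gB x y t φ = B at *
  generalize gV x y t φ = v at *
  generalize gK x y t φ = k at *
  generalize dS (dS (gK x y)) t φ = k2 at *
  generalize dS (gK x y) t φ = k1 at *
  generalize dS (gV x y) t φ = v1 at *
  generalize dS α t φ = a1 at *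
  generalize α t φ = a at *
  have key : (a1 - (k - b t) * v * k) * k + v * kt
      = a1 * k + a * k1 + (k2 * v - k1 * v1) / v ^ 2 := by
    linear_combination (-B) * b1 + A * b2 + (a1 * k + a * k1 + (k2 * v - k1 * v1) / v ^ 2
      - (a1 - (k - b t) * v * k) * k - v * kt) * u
  field_simp at key ⊢
  linear_combination key

end Geo

/-! ### The maximum principle -/

lemma second_deriv_nonpos {f : ℝ → ℝ} {a : ℝ} (hf : ContinuousAt f a) (hm : ∀ s, f s ≤ f a) :
    deriv (deriv f) a ≤ 0 := by
  by_contra hc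
  push Not at hc
  have hmax : IsLocalMax f a := Filter.Eventually.of_forall hm
  have hmin := isLocalMin_of_deriv_deriv_pos hc hmax.deriv_eq_zero hf
  have he : f =ᶠ[nhds a] fun _ => f a := by
    filter_upwards [hmin] with s hs using le_antisymm (hm s) hs
  have h2 : deriv (deriv f) a = 0 := by
    rw [he.deriv.deriv_eq]; simp
  linarith

lemma left_deriv_nonneg {f : ℝ → ℝ} {f' c a : ℝ} (hca : c < a) (hf : HasDerivAt f f' a)
    (hm : ∀ s, c ≤ s → s ≤ a → f s ≤ f a) : 0 ≤ f' := by
  have h1 := (hasDerivWithinAt_iff_tendsto_slope' (s := Set.Iio a) (by simp)).1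
    hf.hasDerivWithinAt
  refine ge_of_tendsto h1 ?_
  have : Set.Ioo c a ∈ nhdsWithin a (Set.Iio a) := Ioo_mem_nhdsLT hca
  filter_upwards [this] with s hs
  rw [slope_def_field]
  exact div_nonneg_of_nonpos (sub_nonpos.2 (hm s hs.1.le hs.2.le)) (sub_nonpos.2 hs.2.le)

namespace Geo

variable {J : Set ℝ} {x y : ℝ → ℝ → ℝ} {α : ℝ → ℝ → ℝ} {b : ℝ → ℝ}

lemma at_max (hJ : IsOpen J) (g : Geo J x y) (fl : Flow J x y α b) {t : ℝ} (ht : t ∈ J) (φ : ℝ)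
    (σ M h c : ℝ) (hct : c < t)
    (hs : ∀ s, σ * (gK x y t s - M * (gP x y t s - h)) ≤ 0)
    (h0 : gK x y t φ - M * (gP x y t φ - h) = 0)
    (hτ : ∀ τ, c ≤ τ → τ ≤ t → σ * (gK x y τ φ - M * (gP x y τ φ - h)) ≤ 0) :
    0 ≤ σ * (M * gK x y t φ * (2 - h * gK x y t φ) - (gK x y t φ ^ 2 + M) * b t) := by
  have hv := g.vpos ht φ
  have hK := g.smK.hasS ht
  have hP := g.smP.hasS ht
  have hK1 := (g.smK.dS g.uniq).hasS ht
  have hP1 := (g.smP.dS g.uniq).hasS ht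
  set f : ℝ → ℝ := fun s => σ * (gK x y t s - M * (gP x y t s - h)) with hfdef
  have d1 : ∀ s, HasDerivAt f (σ * (dS (gK x y) t s - M * dS (gP x y) t s)) s := fun s =>
    ((hK s).sub (((hP s).sub_const h).const_mul M)).const_mul σ
  have d2 : ∀ s, HasDerivAt (deriv f)
      (σ * (dS (dS (gK x y)) t s - M * dS (dS (gP x y)) t s)) s := by
    intro s
    have : deriv f = fun s => σ * (dS (gK x y) t s - M * dS (gP x y) t s) :=
      funext fun s => (d1 s).deriv
    rw [this]
    exact ((hK1 s).sub ((hP1 s).const_mul M)).const_mul σ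
  have hf0 : f φ = 0 := by simp only [hfdef]; rw [h0]; simp
  have hmax : ∀ s, f s ≤ f φ := fun s => by rw [hf0]; exact hs s
  have E1 : σ * (dS (gK x y) t φ - M * dS (gP x y) t φ) = 0 := by
    have : IsLocalMax f φ := Filter.Eventually.of_forall hmax
    rw [← (d1 φ).deriv]; exact this.deriv_eq_zero
  have E2 : σ * (dS (dS (gK x y)) t φ - M * dS (dS (gP x y)) t φ) ≤ 0 := by
    rw [← (d2 φ).deriv]; exact second_deriv_nonpos (d1 φ).continuousAt hmax
  have hT := ((g.smK.hasT hJ ht φ).sub (((g.smP.hasT hJ ht φ).sub_const h).const_mul M)).const_mul σ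
  have E3 : 0 ≤ σ * (dT (gK x y) t φ - M * dT (gP x y) t φ) := by
    refine left_deriv_nonneg hct hT ?_
    intro s h1 h2
    have h3 := hτ s h1 h2
    have h4 : σ * (gK x y t φ - M * (gP x y t φ - h)) = 0 := by rw [h0]; simp
    exact h3.trans h4.ge
  rw [evolK hJ g fl ht, evolP hJ g fl ht] at E3
  rw [g.dSSP ht] at E2
  rw [g.dSP ht] at E1
  generalize gV x y t φ = v at *
  generalize dS (dS (gK x y)) t φ = k2 at *
  generalize dS (gK x y) t φ = k1 at *
  generalize dS (gV x y) t φ = v1 at *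
  generalize gK x y t φ = k at *
  generalize gP x y t φ = p at *
  generalize gQ x y t φ = q at *
  generalize α t φ = a at *
  have hp : M * p = k + M * h := by linarith
  have E2' : (σ * (k2 - M * ((v1 * k + v * k1) * q + v * k * (v - v * k * p)))) / v ^ 2 ≤ 0 :=
    div_nonpos_of_nonpos_of_nonneg E2 (by positivity)
  have id : σ * (a * k1 / v + (k2 * v - k1 * v1) / v ^ 3 + (k - b t) * k ^ 2 -
        M * (-(k - b t) + (a * k + k1 / v) * q))
      - (σ * (k2 - M * ((v1 * k + v * k1) * q + v * k * (v - v * k * p)))) / v ^ 2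
      - σ * (M * k * (2 - h * k) - (k ^ 2 + M) * b t)
      = (a / v - v1 / v ^ 3) * (σ * (k1 - M * (v * k * q))) - σ * k ^ 2 * (M * p - (k + M * h)) := by
    field_simp
    ring
  rw [E1, hp] at id
  simp at id
  linarith

end Geo

lemma periodic_dS {f : ℝ → ℝ → ℝ} {t c : ℝ} (h : Function.Periodic (f t) c) :
    Function.Periodic (dS f t) c := by
  intro s
  have : (fun s => f t (s + c)) = f t := funext h
  simp only [dS]
  rw [← deriv_comp_add_const, this]

lemma Sm.cont {J : Set ℝ} {f : ℝ → ℝ → ℝ} (hf : Sm J f) :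
    ContinuousOn (fun q : ℝ × ℝ => f q.1 q.2) (J ×ˢ (Set.univ : Set ℝ)) := ContDiffOn.continuousOn hf

namespace Geo
variable {J : Set ℝ} {x y : ℝ → ℝ → ℝ} {α : ℝ → ℝ → ℝ} {b : ℝ → ℝ}

lemma periodicV {t c : ℝ} (hx : Function.Periodic (x t) c) (hy : Function.Periodic (y t) c) :
    Function.Periodic (gV x y t) c := fun s => by
  simp only [gV, periodic_dS hx s, periodic_dS hy s]
lemma periodicA {t c : ℝ} (hx : Function.Periodic (x t) c) (hy : Function.Periodic (y t) c) :
    Function.Periodic (gA x y t) c := fun s => by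
  simp only [gA, periodic_dS hx s, periodicV hx hy s]
lemma periodicB {t c : ℝ} (hx : Function.Periodic (x t) c) (hy : Function.Periodic (y t) c) :
    Function.Periodic (gB x y t) c := fun s => by
  simp only [gB, periodic_dS hy s, periodicV hx hy s]
lemma periodicK {t c : ℝ} (hx : Function.Periodic (x t) c) (hy : Function.Periodic (y t) c) :
    Function.Periodic (gK x y t) c := fun s => by
  simp only [gK, periodic_dS hx s, periodic_dS hy s, periodicV hx hy s,
    periodic_dS (periodic_dS hx) s, periodic_dS (periodic_dS hy) s]
lemma periodicP {t c : ℝ} (hx : Function.Periodic (x t) c) (hy : Function.Periodic (y t) c) :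
    Function.Periodic (gP x y t) c := fun s => by
  simp only [gP, periodicA hx hy s, periodicB hx hy s, hx s, hy s]

lemma mono {K : Set ℝ} (g : Geo J x y) (hK : UniqueDiffOn ℝ K) (h : K ⊆ J) : Geo K x y :=
  ⟨hK, g.hx.mono h, g.hy.mono h, fun t ht => g.reg t (h ht)⟩

theorem max_principle {T : ℝ} (hT : 0 < T) (g : Geo (Icc 0 T) x y)
    (fl : Flow (Ioo 0 T) x y α b) (σ h M₀ : ℝ) (hh : 0 < h)
    (hp : ∀ t ∈ Icc 0 T, ∀ φ, 2 * h ≤ gP x y t φ)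
    (hx : ∀ t ∈ Icc 0 T, Function.Periodic (x t) (2 * π))
    (hy : ∀ t ∈ Icc 0 T, Function.Periodic (y t) (2 * π))
    (hinit : ∀ φ, σ * (gK x y 0 φ / (gP x y 0 φ - h)) ≤ M₀)
    (hreact : ∀ t ∈ Ioo 0 T, ∀ φ, ∀ M, gK x y t φ = M * (gP x y t φ - h) → M₀ < σ * M →
      σ * (M * gK x y t φ * (2 - h * gK x y t φ) - (gK x y t φ ^ 2 + M) * b t) < 0) :
    ∀ t ∈ Icc 0 T, ∀ φ, σ * (gK x y t φ / (gP x y t φ - h)) ≤ M₀ := by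
  have hpos : ∀ t ∈ Icc 0 T, ∀ φ, 0 < gP x y t φ - h := fun t ht φ => by
    have := hp t ht φ; linarith
  have hcont : ContinuousOn (fun q : ℝ × ℝ => σ * (gK x y q.1 q.2 / (gP x y q.1 q.2 - h)))
      (Icc 0 T ×ˢ (Set.univ : Set ℝ)) :=
    ((Sm.const σ).mul (g.smK.div (g.smP.sub (Sm.const h)) (fun t ht φ => (hpos t ht φ).ne'))).cont
  have main : ∀ t ∈ Ioo 0 T, ∀ φ, σ * (gK x y t φ / (gP x y t φ - h)) ≤ M₀ := by
    intro t₁ ht₁ φ₁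
    have hsub : Icc 0 t₁ ⊆ Icc 0 T := Icc_subset_Icc_right ht₁.2.le
    obtain ⟨⟨t₀, φ₀⟩, ⟨ht₀, hφ₀⟩, hmax⟩ := (isCompact_Icc.prod isCompact_Icc :
      IsCompact (Icc 0 t₁ ×ˢ Icc 0 (2 * π))).exists_isMaxOn
      ⟨(0, 0), ⟨⟨le_rfl, ht₁.1.le⟩, ⟨le_rfl, by positivity⟩⟩⟩
      (hcont.mono (Set.prod_mono hsub (Set.subset_univ _)))
    have hall : ∀ τ ∈ Icc 0 t₁, ∀ s, σ * (gK x y τ s / (gP x y τ s - h)) ≤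
        σ * (gK x y t₀ φ₀ / (gP x y t₀ φ₀ - h)) := by
      intro τ hτ s
      have hper : Function.Periodic (fun s => σ * (gK x y τ s / (gP x y τ s - h))) (2 * π) := by
        intro s
        simp only [periodicK (hx τ (hsub hτ)) (hy τ (hsub hτ)) s,
          periodicP (hx τ (hsub hτ)) (hy τ (hsub hτ)) s]
      obtain ⟨s', hs', he⟩ := hper.exists_mem_Ico₀ (by positivity) s
      rw [he]
      exact hmax (show (τ, s') ∈ Icc 0 t₁ ×ˢ Icc 0 (2 * π) from ⟨hτ, hs'.1, hs'.2.le⟩)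
    refine (hall t₁ ⟨ht₁.1.le, le_rfl⟩ φ₁).trans ?_
    by_contra hc
    push Not at hc
    simp only at ht₀
    have ht0 : 0 < t₀ := by
      rcases ht₀.1.lt_or_eq with h1 | h1
      · exact h1
      · subst h1; exact absurd (hinit φ₀) (not_le.2 hc)
    have ht0J : t₀ ∈ Ioo 0 T := ⟨ht0, ht₀.2.trans_lt ht₁.2⟩
    set M := gK x y t₀ φ₀ / (gP x y t₀ φ₀ - h) with hM
    have hKM : gK x y t₀ φ₀ = M * (gP x y t₀ φ₀ - h) := by
      rw [hM, div_mul_cancel₀ _ (hpos t₀ (hsub ht₀) φ₀).ne']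
    have hall' : ∀ τ ∈ Icc 0 t₁, ∀ s, σ * (gK x y τ s - M * (gP x y τ s - h)) ≤ 0 := by
      intro τ hτ s
      have h1 := mul_le_mul_of_nonneg_right (hall τ hτ s) (hpos τ (hsub hτ) s).le
      have h2 : σ * (gK x y τ s / (gP x y τ s - h)) * (gP x y τ s - h) = σ * gK x y τ s := by
        rw [mul_assoc, div_mul_cancel₀ _ (hpos τ (hsub hτ) s).ne']
      rw [h2] at h1
      linarith
    have hg := g.mono (isOpen_Ioo.uniqueDiffOn) (Ioo_subset_Icc_self (a := 0) (b := T))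
    have h1 := at_max isOpen_Ioo hg fl ht0J φ₀ σ M h 0 ht0 (hall' t₀ ht₀) (by linarith)
      (fun τ h1 h2 => hall' τ ⟨h1, h2.trans ht₀.2⟩ φ₀)
    exact absurd (hreact t₀ ht0J φ₀ M hKM hc) (not_lt.2 h1)
  intro t ht φ
  have hcl : closure (Ioo 0 T) = Icc 0 T := closure_Ioo hT.ne
  have hc1 : ContinuousOn (fun t => σ * (gK x y t φ / (gP x y t φ - h))) (closure (Ioo 0 T)) := by
    rw [hcl]
    exact hcont.comp (f := fun t : ℝ => ((t, φ) : ℝ × ℝ)) (by fun_prop) (fun t ht => ⟨ht, trivial⟩)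
  exact le_on_closure (fun t ht => main t ht φ) hc1 continuousOn_const (by rw [hcl]; exact ht)

end Geo

/-! ### Length and area -/

lemma Sm.contS {J : Set ℝ} {f : ℝ → ℝ → ℝ} (hf : Sm J f) {t : ℝ} (ht : t ∈ J) :
    Continuous (f t) :=
  continuous_iff_continuousAt.2 fun φ => (hf.hasS ht φ).continuousAt

/-- Differentiation under the integral sign. -/
lemma Sm.hasDerivAt_integral {J : Set ℝ} (hJ : IsOpen J) {f : ℝ → ℝ → ℝ} (hf : Sm J f) {t : ℝ}
    (ht : t ∈ J) :
    HasDerivAt (fun τ => ∫ φ in (0:ℝ)..(2 * π), f τ φ) (∫ φ in (0:ℝ)..(2 * π), _root_.dT f t φ) t := by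
  obtain ⟨ε, hε, hball⟩ := Metric.nhds_basis_closedBall.mem_iff.1 (hJ.mem_nhds ht)
  have hc : IsCompact (Metric.closedBall t ε ×ˢ Icc (0:ℝ) (2 * π)) :=
    (isCompact_closedBall t ε).prod isCompact_Icc
  have hdT := hf.dT hJ
  obtain ⟨C, hC⟩ := hc.exists_bound_of_continuousOn
    (hdT.cont.mono (Set.prod_mono hball (Set.subset_univ _)))
  have h2pi : (0:ℝ) ≤ 2 * π := by positivity
  refine (intervalIntegral.hasDerivAt_integral_of_dominated_loc_of_deriv_le
    (F := f) (F' := _root_.dT f) (bound := fun _ => C)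
    (Metric.closedBall_mem_nhds t hε) ?_ ?_ ?_ ?_ ?_ ?_).2
  · filter_upwards [hJ.mem_nhds ht] with τ hτ
    exact (hf.contS hτ).aestronglyMeasurable
  · exact (hf.contS ht).intervalIntegrable _ _
  · exact (hdT.contS ht).aestronglyMeasurable
  · refine Filter.Eventually.of_forall fun φ hφ τ hτ => ?_
    rw [Set.uIoc_of_le h2pi] at hφ
    exact hC (τ, φ) ⟨hτ, hφ.1.le, hφ.2⟩
  · exact intervalIntegrable_const
  · exact Filter.Eventually.of_forall fun φ _ τ hτ => hf.hasT hJ (hball hτ) φ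

lemma Sm.continuousOn_integral {T : ℝ} (hT : 0 ≤ T) {f : ℝ → ℝ → ℝ} (hf : Sm (Icc 0 T) f) :
    ContinuousOn (fun τ => ∫ φ in (0:ℝ)..(2 * π), f τ φ) (Icc 0 T) := by
  have h1 : Continuous (Function.uncurry
      (fun τ φ => f (Set.projIcc 0 T hT τ : ℝ) φ)) := by
    have h2 : Continuous (fun q : ℝ × ℝ => (((Set.projIcc 0 T hT q.1 : ℝ), q.2) : ℝ × ℝ)) := by
      fun_prop
    exact hf.cont.comp_continuous h2 (fun q => ⟨(Set.projIcc 0 T hT q.1).2, trivial⟩)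
  have h3 := intervalIntegral.continuous_parametric_intervalIntegral_of_continuous'
    (μ := volume) h1 0 (2 * π)
  refine h3.continuousOn.congr fun τ hτ => ?_
  simp only [Set.projIcc_of_mem hT hτ]

namespace Geo
variable {J : Set ℝ} {x y : ℝ → ℝ → ℝ} {α : ℝ → ℝ → ℝ} {b : ℝ → ℝ}

lemma periodic_dT (hJ : IsOpen J) {f : ℝ → ℝ → ℝ} {c : ℝ}
    (h : ∀ t ∈ J, Function.Periodic (f t) c) {t : ℝ} (ht : t ∈ J) :
    Function.Periodic (dT f t) c := by
  intro s
  apply Filter.EventuallyEq.deriv_eq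
  filter_upwards [hJ.mem_nhds ht] with τ hτ using h τ hτ s

lemma integral_beta (hJ : IsOpen J) (g : Geo J x y) (fl : Flow J x y α b)
    (hx : ∀ t ∈ J, Function.Periodic (x t) (2 * π))
    (hy : ∀ t ∈ J, Function.Periodic (y t) (2 * π)) {A₀ : ℝ}
    (hA : ∀ t ∈ J, ∫ φ in (0:ℝ)..(2 * π), (x t φ * dS y t φ - y t φ * dS x t φ) = A₀)
    {t : ℝ} (ht : t ∈ J) :
    ∫ φ in (0:ℝ)..(2 * π), (gK x y t φ - b t) * gV x y t φ = 0 := by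
  have hf : Sm J (fun t φ => x t φ * dS y t φ - y t φ * dS x t φ) :=
    (g.hx.mul g.smy).sub (g.hy.mul g.smx)
  have h1 := hf.hasDerivAt_integral hJ ht
  have h2 : HasDerivAt (fun τ => ∫ φ in (0:ℝ)..(2 * π), (x τ φ * dS y τ φ - y τ φ * dS x τ φ))
      0 t := by
    refine (hasDerivAt_const t A₀).congr_of_eventuallyEq ?_
    filter_upwards [hJ.mem_nhds ht] with τ hτ using hA τ hτ
  have h3 := h1.unique h2
  have hH : Sm J (fun t φ => x t φ * dT y t φ - y t φ * dT x t φ) :=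
    (g.hx.mul (g.hy.dT hJ)).sub (g.hy.mul (g.hx.dT hJ))
  have e : ∀ φ, dT (fun t φ => x t φ * dS y t φ - y t φ * dS x t φ) t φ
      = dS (fun t φ => x t φ * dT y t φ - y t φ * dT x t φ) t φ
        - 2 * ((gK x y t φ - b t) * gV x y t φ) := by
    intro φ
    have a1 : dT (fun t φ => x t φ * dS y t φ - y t φ * dS x t φ) t φ = _ :=
      (((g.hx.hasT hJ ht φ).mul (g.smy.hasT hJ ht φ)).sub
        ((g.hy.hasT hJ ht φ).mul (g.smx.hasT hJ ht φ))).deriv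
    have a2 : dS (fun t φ => x t φ * dT y t φ - y t φ * dT x t φ) t φ = _ :=
      (((g.hx.hasS ht φ).mul ((g.hy.dT hJ).hasS ht φ)).sub
        ((g.hy.hasS ht φ).mul ((g.hx.dT hJ).hasS ht φ))).deriv
    rw [a1, a2, g.hx.comm hJ ht, g.hy.comm hJ ht, g.dSx ht, g.dSy ht, (fl t ht φ).1, (fl t ht φ).2]
    linear_combination (-2 * gV x y t φ * (gK x y t φ - b t)) * g.unit ht φ
  have hb : Continuous (fun φ => (gK x y t φ - b t) * gV x y t φ) :=
    ((g.smK.contS ht).sub continuous_const).mul (g.smV.contS ht)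
  have hb' : Continuous (fun φ => 2 * ((gK x y t φ - b t) * gV x y t φ)) := continuous_const.mul hb
  have hHc := (hH.dS g.uniq).contS ht
  rw [intervalIntegral.integral_congr (fun φ _ => e φ), intervalIntegral.integral_sub
    (hHc.intervalIntegrable _ _) (hb'.intervalIntegrable _ _),
    intervalIntegral.integral_const_mul,
    intervalIntegral.integral_eq_sub_of_hasDerivAt (fun φ _ => hH.hasS ht φ)
      (hHc.intervalIntegrable _ _)] at h3
  have p1 := hx t ht 0
  have p2 := hy t ht 0
  have p3 := periodic_dT hJ hx ht 0
  have p4 := periodic_dT hJ hy ht 0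
  rw [zero_add] at p1 p2 p3 p4
  rw [p1, p2, p3, p4] at h3
  linarith

lemma length_deriv (hJ : IsOpen J) (g : Geo J x y) (fl : Flow J x y α b)
    (hx : ∀ t ∈ J, Function.Periodic (x t) (2 * π))
    (hy : ∀ t ∈ J, Function.Periodic (y t) (2 * π)) {A₀ : ℝ}
    (hA : ∀ t ∈ J, ∫ φ in (0:ℝ)..(2 * π), (x t φ * dS y t φ - y t φ * dS x t φ) = A₀)
    {t : ℝ} (ht : t ∈ J) :
    ∃ L' : ℝ, L' ≤ 0 ∧ HasDerivAt (fun τ => ∫ φ in (0:ℝ)..(2 * π), gV x y τ φ) L' t := by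
  refine ⟨_, ?_, g.smV.hasDerivAt_integral hJ ht⟩
  have hα := smAl hJ g fl
  have hβ := integral_beta hJ g fl hx hy hA ht
  have hKc := g.smK.contS ht
  have hVc := g.smV.contS ht
  have hb : Continuous (fun φ => (gK x y t φ - b t) * gV x y t φ) :=
    (hKc.sub continuous_const).mul hVc
  have hb2 : Continuous (fun φ => (gK x y t φ - b t) ^ 2 * gV x y t φ) :=
    ((hKc.sub continuous_const).pow 2).mul hVc
  have hac := (hα.dS g.uniq).contS ht
  have hb' : Continuous (fun φ => b t * ((gK x y t φ - b t) * gV x y t φ)) :=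
    continuous_const.mul hb
  have hac' : Continuous (fun φ => dS α t φ - (gK x y t φ - b t) ^ 2 * gV x y t φ) := hac.sub hb2
  have e : ∀ φ, dT (gV x y) t φ = dS α t φ - (gK x y t φ - b t) ^ 2 * gV x y t φ
      - b t * ((gK x y t φ - b t) * gV x y t φ) := by
    intro φ
    rw [(evol1 hJ g fl ht φ).1]; ring
  rw [intervalIntegral.integral_congr (fun φ _ => e φ), intervalIntegral.integral_sub
    (hac'.intervalIntegrable _ _) (hb'.intervalIntegrable _ _),
    intervalIntegral.integral_sub
    (hac.intervalIntegrable _ _) (hb2.intervalIntegrable _ _),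
    intervalIntegral.integral_const_mul, hβ,
    intervalIntegral.integral_eq_sub_of_hasDerivAt (fun φ _ => hα.hasS ht φ)
      (hac.intervalIntegrable _ _)]
  have hp : α t (2 * π) = α t 0 := by
    have p3 := periodic_dT hJ hx ht 0
    have p4 := periodic_dT hJ hy ht 0
    have p5 := periodicA (hx t ht) (hy t ht) 0
    have p6 := periodicB (hx t ht) (hy t ht) 0
    rw [zero_add] at p3 p4 p5 p6
    rw [g.alpha_eq fl ht, g.alpha_eq fl ht, p3, p4, p5, p6]
  have hn : 0 ≤ ∫ φ in (0:ℝ)..(2 * π), (gK x y t φ - b t) ^ 2 * gV x y t φ :=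
    intervalIntegral.integral_nonneg (by positivity) fun φ _ =>
      mul_nonneg (sq_nonneg _) (g.vpos ht φ).le
  rw [hp]
  linarith

lemma length_anti {T : ℝ} (hT : 0 < T) (g : Geo (Icc 0 T) x y)
    (fl : Flow (Ioo 0 T) x y α b)
    (hx : ∀ t ∈ Icc 0 T, Function.Periodic (x t) (2 * π))
    (hy : ∀ t ∈ Icc 0 T, Function.Periodic (y t) (2 * π)) {A₀ : ℝ}
    (hA : ∀ t ∈ Icc 0 T, ∫ φ in (0:ℝ)..(2 * π), (x t φ * dS y t φ - y t φ * dS x t φ) = A₀)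
    {t : ℝ} (ht : t ∈ Icc 0 T) :
    ∫ φ in (0:ℝ)..(2 * π), gV x y t φ ≤ ∫ φ in (0:ℝ)..(2 * π), gV x y 0 φ := by
  have hg := g.mono (isOpen_Ioo.uniqueDiffOn) (Ioo_subset_Icc_self (a := 0) (b := T))
  have hd := fun t (ht : t ∈ Ioo 0 T) => length_deriv isOpen_Ioo hg fl
    (fun t ht => hx t (Ioo_subset_Icc_self ht)) (fun t ht => hy t (Ioo_subset_Icc_self ht))
    (fun t ht => hA t (Ioo_subset_Icc_self ht)) ht
  have := antitoneOn_of_deriv_nonpos (convex_Icc 0 T) (g.smV.continuousOn_integral hT.le)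
    (by
      rw [interior_Icc]
      intro t ht
      obtain ⟨_, -, h⟩ := hd t ht
      exact h.differentiableAt.differentiableWithinAt)
    (by
      rw [interior_Icc]
      intro t ht
      obtain ⟨_, h0, h⟩ := hd t ht
      rw [h.deriv]; exact h0)
  exact this ⟨le_rfl, hT.le⟩ ht ht.1

/-- The support function is at most half of the length. -/
lemma supp_le (g : Geo J x y) {t : ℝ} (ht : t ∈ J)
    (hx : Function.Periodic (x t) (2 * π)) (hy : Function.Periodic (y t) (2 * π))
    (hp : ∀ φ, 0 < gP x y t φ) (φ₀ : ℝ) :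
    gP x y t φ₀ ≤ (∫ φ in (0:ℝ)..(2 * π), gV x y t φ) / 2 := by
  have u := g.unit ht φ₀
  have hf0 : x t φ₀ * gB x y t φ₀ - y t φ₀ * gA x y t φ₀ = gP x y t φ₀ := rfl
  generalize gA x y t φ₀ = A at *
  generalize gB x y t φ₀ = B at *
  set f : ℝ → ℝ := fun s => x t s * B - y t s * A with hf
  set k : ℝ → ℝ := fun s => x t s * A + y t s * B with hk
  have df : ∀ s, HasDerivAt f (dS x t s * B - dS y t s * A) s := fun s =>
    ((g.hx.hasS ht s).mul_const B).sub ((g.hy.hasS ht s).mul_const A)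
  have dk : ∀ s, HasDerivAt k (dS x t s * A + dS y t s * B) s := fun s =>
    ((g.hx.hasS ht s).mul_const A).add ((g.hy.hasS ht s).mul_const B)
  have fper : Function.Periodic f (2 * π) := fun s => by simp only [hf, hx s, hy s]
  have kper : Function.Periodic k (2 * π) := fun s => by simp only [hk, hx s, hy s]
  have hπ : 0 < 2 * π := by positivity
  have hex : ∃ s, f s ≤ 0 := by
    by_contra hc
    push Not at hc
    have hmono : StrictMono (fun s => k s / f s) := by
      apply strictMono_of_deriv_pos
      intro s
      have hq : deriv (fun s => k s / f s) s = _ := ((dk s).div (df s) (hc s).ne').deriv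
      rw [hq]
      apply div_pos _ (pow_pos (hc s) 2)
      have e : (dS x t s * A + dS y t s * B) * f s - k s * (dS x t s * B - dS y t s * A)
          = gV x y t s * gP x y t s := by
        have e1 := g.dSx ht s
        have e2 := g.dSy ht s
        simp only [hf, hk, gP]
        rw [e1, e2]
        linear_combination (gV x y t s * (x t s * gB x y t s - y t s * gA x y t s)) * u
      rw [e]
      exact mul_pos (g.vpos ht s) (hp s)
    have h1 := hmono (show φ₀ < φ₀ + 2 * π by linarith)
    simp only [fper φ₀, kper φ₀] at h1
    exact lt_irrefl _ h1
  obtain ⟨s', hs'⟩ := hex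
  obtain ⟨s, hs, he⟩ := fper.exists_mem_Ico hπ s' φ₀
  rw [he] at hs'
  have hVc := g.smV.contS ht
  have hdc : Continuous (fun s => dS x t s * B - dS y t s * A) :=
    ((g.smx.contS ht).mul continuous_const).sub ((g.smy.contS ht).mul continuous_const)
  have hbd : ∀ s, |dS x t s * B - dS y t s * A| ≤ gV x y t s := by
    intro s
    apply abs_le_of_sq_le_sq _ (g.vpos ht s).le
    rw [g.vsq ht s]
    nlinarith [sq_nonneg (dS x t s * A + dS y t s * B)]
  have i1 : ∫ r in φ₀..s, (dS x t r * B - dS y t r * A) = f s - f φ₀ :=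
    intervalIntegral.integral_eq_sub_of_hasDerivAt (fun r _ => df r) (hdc.intervalIntegrable _ _)
  have i2 : ∫ r in s..(φ₀ + 2 * π), (dS x t r * B - dS y t r * A) = f (φ₀ + 2 * π) - f s :=
    intervalIntegral.integral_eq_sub_of_hasDerivAt (fun r _ => df r) (hdc.intervalIntegrable _ _)
  have j1 : ∫ r in φ₀..s, -(dS x t r * B - dS y t r * A) ≤ ∫ r in φ₀..s, gV x y t r :=
    intervalIntegral.integral_mono_on hs.1 (hdc.neg.intervalIntegrable _ _)
      (hVc.intervalIntegrable _ _) (fun r _ => (neg_le_abs _).trans (hbd r))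
  have j2 : ∫ r in s..(φ₀ + 2 * π), (dS x t r * B - dS y t r * A) ≤
      ∫ r in s..(φ₀ + 2 * π), gV x y t r :=
    intervalIntegral.integral_mono_on hs.2.le (hdc.intervalIntegrable _ _)
      (hVc.intervalIntegrable _ _) (fun r _ => (le_abs_self _).trans (hbd r))
  rw [intervalIntegral.integral_neg, i1] at j1
  rw [i2, fper φ₀] at j2
  have j3 : (∫ r in φ₀..s, gV x y t r) + ∫ r in s..(φ₀ + 2 * π), gV x y t r
      = ∫ r in φ₀..(φ₀ + 2 * π), gV x y t r :=
    intervalIntegral.integral_add_adjacent_intervals (hVc.intervalIntegrable _ _)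
      (hVc.intervalIntegrable _ _)
  have j4 := (periodicV hx hy).intervalIntegral_add_eq φ₀ 0
  rw [zero_add] at j4
  have hf1 : f φ₀ = gP x y t φ₀ := hf0
  linarith

lemma area_le (g : Geo J x y) {t : ℝ} (ht : t ∈ J) {C : ℝ}
    (hp : ∀ φ, gP x y t φ ≤ C) :
    ∫ φ in (0:ℝ)..(2 * π), (x t φ * dS y t φ - y t φ * dS x t φ) ≤
      C * ∫ φ in (0:ℝ)..(2 * π), gV x y t φ := by
  rw [← intervalIntegral.integral_const_mul]
  have hVc := g.smV.contS ht
  refine intervalIntegral.integral_mono_on (by positivity)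
    ((((g.hx.contS ht).mul (g.smy.contS ht)).sub
      ((g.hy.contS ht).mul (g.smx.contS ht))).intervalIntegrable _ _)
    ((continuous_const.mul hVc).intervalIntegrable _ _) (fun φ _ => ?_)
  have e : x t φ * dS y t φ - y t φ * dS x t φ = gP x y t φ * gV x y t φ := by
    rw [g.dSx ht, g.dSy ht]; simp only [gP]; ring
  rw [e]
  exact mul_le_mul_of_nonneg_right (hp φ) (g.vpos ht φ).le

lemma le_area (g : Geo J x y) {t : ℝ} (ht : t ∈ J) {C : ℝ}
    (hp : ∀ φ, C ≤ gP x y t φ) :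
    C * ∫ φ in (0:ℝ)..(2 * π), gV x y t φ ≤
      ∫ φ in (0:ℝ)..(2 * π), (x t φ * dS y t φ - y t φ * dS x t φ) := by
  rw [← intervalIntegral.integral_const_mul]
  have hVc := g.smV.contS ht
  refine intervalIntegral.integral_mono_on (by positivity)
    ((continuous_const.mul hVc).intervalIntegrable _ _)
    ((((g.hx.contS ht).mul (g.smy.contS ht)).sub
      ((g.hy.contS ht).mul (g.smx.contS ht))).intervalIntegrable _ _) (fun φ _ => ?_)
  have e : x t φ * dS y t φ - y t φ * dS x t φ = gP x y t φ * gV x y t φ := by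
    rw [g.dSx ht, g.dSy ht]; simp only [gP]; ring
  rw [e]
  exact mul_le_mul_of_nonneg_right (hp φ) (g.vpos ht φ).le

lemma length_pos (g : Geo J x y) {t : ℝ} (ht : t ∈ J) :
    0 < ∫ φ in (0:ℝ)..(2 * π), gV x y t φ :=
  intervalIntegral.intervalIntegral_pos_of_pos ((g.smV.contS ht).intervalIntegrable _ _)
    (fun φ => g.vpos ht φ) (by positivity)

end Geo

lemma react_upper {M k d h b : ℝ} (hh : 0 < h) (hd : h ≤ d) (hb : 0 < b) (hk : k = M * d)
    (hM : 2 / h ^ 2 < M) : M * k * (2 - h * k) - (k ^ 2 + M) * b < 0 := by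
  have hM0 : 0 < M := lt_trans (by positivity) hM
  rw [div_lt_iff₀ (by positivity)] at hM
  have h1 : M * h ≤ k := by rw [hk]; exact mul_le_mul_of_nonneg_left hd hM0.le
  have hk0 : 0 < k := lt_of_lt_of_le (by positivity) h1
  have h2 : 2 < h * k := by nlinarith
  have h3 : M * k * (2 - h * k) < 0 := mul_neg_of_pos_of_neg (by positivity) (by linarith)
  have h4 : 0 < (k ^ 2 + M) * b := by positivity
  linarith

lemma react_lower {M k p h L A : ℝ} (hh : 0 < h) (hp : 2 * h ≤ p) (hL : 0 < L) (hA : 0 < A)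
    (hpL : p ≤ L / 2) (hAL : 4 * A ≤ L ^ 2) (hk : k = M * (p - h))
    (hM : M < -(2 * π) / (Real.sqrt (4 * π * A) * h)) :
    0 < M * k * (2 - h * k) - (k ^ 2 + M) * (2 * π / L) := by
  have hπ := Real.pi_pos
  have hπ4 := Real.pi_lt_four
  have hS : 0 < Real.sqrt (4 * π * A) := Real.sqrt_pos.2 (by positivity)
  have hS2 : Real.sqrt (4 * π * A) ≤ 2 * L := by
    apply Real.sqrt_le_iff.2 ⟨by positivity, ?_⟩
    nlinarith
  rw [lt_div_iff₀ (by positivity)] at hM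
  set S := Real.sqrt (4 * π * A)
  obtain ⟨m, rfl⟩ : ∃ m, M = -m := ⟨-M, by ring⟩
  have hm0 : 0 < m := by
    by_contra hc
    have : 0 ≤ -m * (S * h) := mul_nonneg (by linarith) (by positivity)
    linarith
  have h1 : π / L < h * m := by
    rw [div_lt_iff₀ hL]
    have : m * h * S ≤ m * h * (2 * L) := mul_le_mul_of_nonneg_left hS2 (by positivity)
    linarith
  obtain ⟨d, rfl⟩ : ∃ d, p = d + h := ⟨p - h, by ring⟩
  have hd : 0 < d := by linarith
  have hdL : π / L * d < 2 := by
    rw [div_mul_eq_mul_div, div_lt_iff₀ hL]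
    nlinarith
  have h2 : π / L * d ≤ h * m * d := mul_le_mul_of_nonneg_right h1.le hd.le
  have e : -m * k * (2 - h * k) - (k ^ 2 + -m) * (2 * π / L)
      = m ^ 2 * d * (2 + h * m * d - 2 * (π / L * d)) + m * (2 * π / L) := by
    rw [hk]; ring
  rw [e]
  have h3 : 0 < m * (2 * π / L) := by positivity
  have h4 : 0 ≤ m ^ 2 * d * (2 + h * m * d - 2 * (π / L * d)) :=
    mul_nonneg (by positivity) (by linarith)
  linarith

/-! ### Translation to coordinates -/

/-- First coordinate. -/
def cx (X : ℝ → ℝ → ℝ × ℝ) (t φ : ℝ) : ℝ := (X t φ).1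
/-- Second coordinate. -/
def cy (X : ℝ → ℝ → ℝ × ℝ) (t φ : ℝ) : ℝ := (X t φ).2

section translate
variable {X : ℝ → ℝ → ℝ × ℝ} {t : ℝ}

lemma deriv_pair {Y : ℝ → ℝ × ℝ} {φ : ℝ} (h : DifferentiableAt ℝ Y φ) :
    deriv Y φ = (deriv (fun s => (Y s).1) φ, deriv (fun s => (Y s).2) φ) := by
  have h1 := h.hasDerivAt
  have h2 : HasDerivAt (fun s => (Y s).1) (deriv Y φ).1 φ := h1.fst
  have h3 : HasDerivAt (fun s => (Y s).2) (deriv Y φ).2 φ := h1.snd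
  rw [h2.deriv, h3.deriv]

lemma tr1 (hc : IsSmoothClosedCurve (X t)) (φ : ℝ) :
    deriv (X t) φ = (dS (cx X) t φ, dS (cy X) t φ) :=
  deriv_pair (hc.smooth.differentiable (by simp) φ)

lemma tr2 (hc : IsSmoothClosedCurve (X t)) (φ : ℝ) :
    deriv (deriv (X t)) φ = (dS (dS (cx X)) t φ, dS (dS (cy X)) t φ) := by
  have hd : ContDiff ℝ 1 (deriv (X t)) := by
    have h2 : ContDiff ℝ (1 + 1) (X t) := hc.smooth.of_le (by norm_cast)
    exact (contDiff_succ_iff_deriv.1 h2).2.2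
  rw [deriv_pair (hd.differentiable (by simp) φ)]
  simp only [tr1 hc]
  rfl

lemma tr_vnorm (hc : IsSmoothClosedCurve (X t)) (φ : ℝ) :
    vnorm (deriv (X t) φ) = gV (cx X) (cy X) t φ := by
  rw [tr1 hc]; rfl

lemma tr_curv (hc : IsSmoothClosedCurve (X t)) (φ : ℝ) :
    curv (X t) φ = gK (cx X) (cy X) t φ := by
  simp only [curv]
  rw [tr_vnorm hc, tr2 hc, tr1 hc]; rfl

lemma tr_tan (hc : IsSmoothClosedCurve (X t)) (φ : ℝ) :
    unitTangent (X t) φ = (gA (cx X) (cy X) t φ, gB (cx X) (cy X) t φ) := by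
  simp only [unitTangent]
  rw [tr_vnorm hc, tr1 hc]
  simp [gA, gB, div_eq_inv_mul]

lemma tr_supp (hc : IsSmoothClosedCurve (X t)) (φ : ℝ) :
    suppFn X t φ = gP (cx X) (cy X) t φ := by
  simp only [suppFn]
  rw [tr_tan hc]; rfl

lemma tr_len (hc : IsSmoothClosedCurve (X t)) :
    clen (X t) = ∫ φ in (0:ℝ)..(2 * π), gV (cx X) (cy X) t φ := by
  simp only [clen, tr_vnorm hc]

lemma tr_area (hc : IsSmoothClosedCurve (X t)) :
    carea (X t) = (1 / 2) * ∫ φ in (0:ℝ)..(2 * π),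
      (cx X t φ * dS (cy X) t φ - cy X t φ * dS (cx X) t φ) := by
  simp only [carea, tr1 hc]; rfl

lemma tr_perx (hc : IsSmoothClosedCurve (X t)) : Function.Periodic (cx X t) (2 * π) := fun s => by
  simp only [cx, hc.periodic s]

lemma tr_pery (hc : IsSmoothClosedCurve (X t)) : Function.Periodic (cy X t) (2 * π) := fun s => by
  simp only [cy, hc.periodic s]

lemma tr_reg (hc : IsSmoothClosedCurve (X t)) (φ : ℝ) :
    0 < dS (cx X) t φ ^ 2 + dS (cy X) t φ ^ 2 := by
  have h := hc.regular φ
  rw [tr1 hc] at h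
  by_contra hn
  apply h
  have h1 : dS (cx X) t φ = 0 := by nlinarith [sq_nonneg (dS (cx X) t φ), sq_nonneg (dS (cy X) t φ)]
  have h2 : dS (cy X) t φ = 0 := by nlinarith [sq_nonneg (dS (cx X) t φ), sq_nonneg (dS (cy X) t φ)]
  rw [h1, h2]; rfl

/-- A single curve seen as a constant family. -/
lemma geo_single (hc : IsSmoothClosedCurve (X t)) :
    Geo Set.univ (cx (fun _ => X t)) (cy (fun _ => X t)) where
  uniq := uniqueDiffOn_univ
  hx := (contDiff_fst.comp (hc.smooth.comp contDiff_snd)).contDiffOn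
  hy := (contDiff_snd.comp (hc.smooth.comp contDiff_snd)).contDiffOn
  reg := fun _ _ φ => tr_reg hc φ

end translate

/-- One curve facts: half-length bound, area bounds, bounds for `φ₄`. -/
lemma single_supp_le {X : ℝ → ℝ → ℝ × ℝ} {t : ℝ} (hc : IsSmoothClosedCurve (X t)) {h : ℝ}
    (hh : 0 < h) (hs : ∀ φ, 2 * h ≤ suppFn X t φ) (φ : ℝ) : suppFn X t φ ≤ clen (X t) / 2 := by
  have hp : ∀ φ, 0 < gP (cx X) (cy X) t φ := fun φ => by
    rw [← tr_supp hc]; linarith [hs φ]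
  rw [tr_supp hc, tr_len hc]
  exact (geo_single hc).supp_le (t := t) trivial (tr_perx hc) (tr_pery hc) hp φ

lemma single_len_pos {X : ℝ → ℝ → ℝ × ℝ} {t : ℝ} (hc : IsSmoothClosedCurve (X t)) :
    0 < clen (X t) := by
  rw [tr_len hc]
  exact (geo_single hc).length_pos (t := t) trivial

lemma single_area_le {X : ℝ → ℝ → ℝ × ℝ} {t : ℝ} (hc : IsSmoothClosedCurve (X t)) {h : ℝ}
    (hh : 0 < h) (hs : ∀ φ, 2 * h ≤ suppFn X t φ) : 4 * carea (X t) ≤ clen (X t) ^ 2 := by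
  have hp : ∀ φ, gP (cx X) (cy X) t φ ≤ clen (X t) / 2 := fun φ => by
    rw [← tr_supp hc]; exact single_supp_le hc hh hs φ
  have h1 : _ ≤ clen (X t) / 2 * ∫ φ in (0:ℝ)..(2 * π), gV (cx X) (cy X) t φ :=
    (geo_single hc).area_le (t := t) trivial hp
  rw [← tr_len hc] at h1
  have h2 := tr_area hc
  change ∫ φ in (0:ℝ)..(2 * π),
      (cx X t φ * dS (cy X) t φ - cy X t φ * dS (cx X) t φ) ≤ _ at h1
  nlinarith

lemma single_area_pos {X : ℝ → ℝ → ℝ × ℝ} {t : ℝ} (hc : IsSmoothClosedCurve (X t)) {h : ℝ}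
    (hh : 0 < h) (hs : ∀ φ, 2 * h ≤ suppFn X t φ) : 0 < carea (X t) := by
  have hp : ∀ φ, 2 * h ≤ gP (cx X) (cy X) t φ := fun φ => by
    rw [← tr_supp hc]; exact hs φ
  have h1 : 2 * h * ∫ φ in (0:ℝ)..(2 * π), gV (cx X) (cy X) t φ ≤ _ :=
    (geo_single hc).le_area (t := t) trivial hp
  rw [← tr_len hc] at h1
  have h2 := tr_area hc
  change _ ≤ ∫ φ in (0:ℝ)..(2 * π),
      (cx X t φ * dS (cy X) t φ - cy X t φ * dS (cx X) t φ) at h1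
  have h3 : 0 < 2 * h * clen (X t) := mul_pos (by linarith) (single_len_pos hc)
  linarith

lemma phi4_init {X : ℝ → ℝ → ℝ × ℝ} (hc : IsSmoothClosedCurve (X 0)) {h : ℝ}
    (hh : 0 < h) (hs : ∀ φ, 2 * h ≤ suppFn X 0 φ) (φ : ℝ) :
    phi4Min X h ≤ phi4 X h 0 φ ∧ phi4 X h 0 φ ≤ phi4Max X h := by
  have g := geo_single hc
  have e : phi4 X h 0 = fun φ => gK (cx X) (cy X) 0 φ / (gP (cx X) (cy X) 0 φ - h) := by
    funext φ; simp only [phi4, tr_curv hc, tr_supp hc]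
  have hcK : Continuous (gK (cx X) (cy X) 0) := g.smK.contS (t := 0) trivial
  have hcP : Continuous (gP (cx X) (cy X) 0) := g.smP.contS (t := 0) trivial
  have hcont : Continuous (phi4 X h 0) := by
    rw [e]
    refine hcK.div (hcP.sub continuous_const) fun φ => ?_
    have := hs φ
    rw [tr_supp hc] at this
    linarith
  have hper : Function.Periodic (phi4 X h 0) (2 * π) := by
    rw [e]
    intro s
    simp only [Geo.periodicK (tr_perx hc) (tr_pery hc) s,
      Geo.periodicP (tr_perx hc) (tr_pery hc) s]
  obtain ⟨s, hs1, hs2⟩ := hper.exists_mem_Ico₀ (by positivity) φ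
  have hmem : phi4 X h 0 φ ∈ (fun φ => phi4 X h 0 φ) '' Set.Icc (0:ℝ) (2 * π) :=
    ⟨s, ⟨hs1.1, hs1.2.le⟩, hs2.symm⟩
  have hK : IsCompact ((fun φ => phi4 X h 0 φ) '' Set.Icc (0:ℝ) (2 * π)) :=
    isCompact_Icc.image hcont
  exact ⟨csInf_le hK.bddBelow hmem, le_csSup hK.bddAbove hmem⟩

/-- The bounds for `φ₄` and the monotonicity of the length for `T > 0`. -/
lemma positive_time (X : ℝ → ℝ → ℝ × ℝ) (T A₀ h : ℝ) (hT : 0 < T) (hh : 0 < h)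
    (hsol : IsGAPFSolutionOn X (X 0) (Set.Icc 0 T))
    (harea : ∀ t ∈ Set.Icc (0:ℝ) T, carea (X t) = A₀)
    (hsupp : ∀ t ∈ Set.Icc (0:ℝ) T, ∀ φ, 2 * h ≤ suppFn X t φ) :
    ∀ t ∈ Set.Icc (0:ℝ) T, clen (X t) ≤ clen (X 0) ∧ ∀ φ,
      (phi4 X h t φ ≤ max (phi4Max X h) (2 / h ^ 2)) ∧
      (min (phi4Min X h) (-(2 * π) / (Real.sqrt (4 * π * A₀) * h)) ≤ phi4 X h t φ) := by
  have hc := hsol.curve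
  have h0 : (0:ℝ) ∈ Icc 0 T := ⟨le_rfl, hT.le⟩
  have g : Geo (Icc 0 T) (cx X) (cy X) :=
    ⟨uniqueDiffOn_Icc hT, contDiff_fst.comp_contDiffOn hsol.smooth,
      contDiff_snd.comp_contDiffOn hsol.smooth, fun t ht φ => tr_reg (hc t ht) φ⟩
  obtain ⟨α, hα⟩ := hsol.flow
  have fl : Geo.Flow (Ioo 0 T) (cx X) (cy X) α (fun t => 2 * π / clen (X t)) := by
    intro t ht φ
    have ht' := Ioo_subset_Icc_self ht
    have h1 := (hα t ht' φ).hasDerivAt (Icc_mem_nhds ht.1 ht.2)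
    simp only [innerNormal] at h1
    rw [tr_tan (hc t ht'), tr_curv (hc t ht')] at h1
    have h2 : HasDerivAt (fun τ => cx X τ φ) _ t := h1.fst
    have h3 : HasDerivAt (fun τ => cy X τ φ) _ t := h1.snd
    constructor
    · have : dT (cx X) t φ = _ := h2.deriv
      rw [this]; simp; ring
    · have : dT (cy X) t φ = _ := h3.deriv
      rw [this]; simp
  have hp : ∀ t ∈ Icc 0 T, ∀ φ, 2 * h ≤ gP (cx X) (cy X) t φ := fun t ht φ => by
    rw [← tr_supp (hc t ht)]; exact hsupp t ht φ
  have hA : ∀ t ∈ Icc 0 T, ∫ φ in (0:ℝ)..(2 * π),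
      (cx X t φ * dS (cy X) t φ - cy X t φ * dS (cx X) t φ) = 2 * A₀ := fun t ht => by
    rw [← harea t ht, tr_area (hc t ht)]; ring
  have hphi : ∀ t ∈ Icc 0 T, ∀ φ, phi4 X h t φ =
      gK (cx X) (cy X) t φ / (gP (cx X) (cy X) t φ - h) := fun t ht φ => by
    simp only [phi4, tr_curv (hc t ht), tr_supp (hc t ht)]
  have up := Geo.max_principle hT g fl 1 h (max (phi4Max X h) (2 / h ^ 2)) hh hp
    (fun t ht => tr_perx (hc t ht)) (fun t ht => tr_pery (hc t ht))
    (fun φ => by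
      rw [one_mul, ← hphi 0 h0]
      exact (phi4_init (hc 0 h0) hh (hsupp 0 h0) φ).2.trans (le_max_left _ _))
    (fun t ht φ M hk hM => by
      rw [one_mul] at hM ⊢
      have ht' := Ioo_subset_Icc_self ht
      refine react_upper hh ?_ ?_ hk ((le_max_right _ _).trans_lt hM)
      · linarith [hp t ht' φ]
      · have := single_len_pos (hc t ht')
        positivity)
  have lo := Geo.max_principle hT g fl (-1) h
    (-(min (phi4Min X h) (-(2 * π) / (Real.sqrt (4 * π * A₀) * h)))) hh hp
    (fun t ht => tr_perx (hc t ht)) (fun t ht => tr_pery (hc t ht))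
    (fun φ => by
      rw [← hphi 0 h0]
      have := (min_le_left (phi4Min X h) (-(2 * π) / (Real.sqrt (4 * π * A₀) * h))).trans
        (phi4_init (hc 0 h0) hh (hsupp 0 h0) φ).1
      linarith)
    (fun t ht φ M hk hM => by
      have ht' := Ioo_subset_Icc_self ht
      have hM' : M < -(2 * π) / (Real.sqrt (4 * π * A₀) * h) :=
        lt_of_lt_of_le (by linarith) (min_le_right (phi4Min X h) _)
      have hAp := single_area_pos (hc t ht') hh (hsupp t ht')
      have hAl := single_area_le (hc t ht') hh (hsupp t ht')
      have hsl := single_supp_le (hc t ht') hh (hsupp t ht') φ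
      rw [harea t ht'] at hAp hAl
      rw [tr_supp (hc t ht')] at hsl
      have := react_lower hh (hp t ht' φ) (single_len_pos (hc t ht')) hAp hsl hAl hk hM'
      linarith)
  intro t ht
  constructor
  · rw [tr_len (hc t ht), tr_len (hc 0 h0)]
    exact Geo.length_anti hT g fl (fun t ht => tr_perx (hc t ht)) (fun t ht => tr_pery (hc t ht))
      hA ht
  · intro φ
    have a1 := up t ht φ
    have a2 := lo t ht φ
    rw [← hphi t ht] at a1 a2
    exact ⟨by linarith, by linarith⟩

/-- If along Gage's area-preserving flow the support function satisfies `p ≥ 2h > 0`,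
then `κ/(p − h)` is bounded between `min{min φ₄(·,0), −2π/(√(4πA₀) h)}` and
`max{max φ₄(·,0), 2/h²}`; in particular, since `h ≤ p ≤ L(0)/2`, the curvature is
bounded above by `(L(0)/2 − h)·max{...}` and below by `(L(0)/2 − h)·min{...}`. -/
theorem gapf_curvature_bound_via_support
    (X : ℝ → ℝ → ℝ × ℝ) (T A₀ h : ℝ) (hT : 0 ≤ T) (hh : 0 < h)
    (hsol : IsGAPFSolutionOn X (X 0) (Set.Icc 0 T))
    (harea : ∀ t ∈ Set.Icc (0:ℝ) T, carea (X t) = A₀)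
    (hsupp : ∀ t ∈ Set.Icc (0:ℝ) T, ∀ φ, 2 * h ≤ suppFn X t φ) :
    ∀ t ∈ Set.Icc (0:ℝ) T, ∀ φ,
      (phi4 X h t φ ≤ max (phi4Max X h) (2 / h ^ 2)) ∧
      (min (phi4Min X h) (-(2 * π) / (Real.sqrt (4 * π * A₀) * h)) ≤ phi4 X h t φ) ∧
      (curv (X t) φ ≤ (clen (X 0) / 2 - h) * max (phi4Max X h) (2 / h ^ 2)) ∧
      ((clen (X 0) / 2 - h) *
          min (phi4Min X h) (-(2 * π) / (Real.sqrt (4 * π * A₀) * h)) ≤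
        curv (X t) φ) := by
  have hc := hsol.curve
  have h0 : (0:ℝ) ∈ Icc 0 T := ⟨le_rfl, hT⟩
  have key : ∀ t ∈ Set.Icc (0:ℝ) T, clen (X t) ≤ clen (X 0) ∧ ∀ φ,
      (phi4 X h t φ ≤ max (phi4Max X h) (2 / h ^ 2)) ∧
      (min (phi4Min X h) (-(2 * π) / (Real.sqrt (4 * π * A₀) * h)) ≤ phi4 X h t φ) := by
    rcases hT.eq_or_lt with h1 | h1
    · intro t ht
      have ht0 : t = 0 := by
        have := ht.1
        have := ht.2
        linarith
      subst ht0
      refine ⟨le_rfl, fun φ => ?_⟩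
      have := phi4_init (hc 0 h0) hh (hsupp 0 h0) φ
      exact ⟨this.2.trans (le_max_left _ _), (min_le_left _ _).trans this.1⟩
    · exact positive_time X T A₀ h h1 hh hsol harea hsupp
  intro t ht φ
  obtain ⟨hl, hb⟩ := key t ht
  obtain ⟨b1, b2⟩ := hb φ
  refine ⟨b1, b2, ?_⟩
  have hs := hsupp t ht φ
  have hle : suppFn X t φ - h ≤ clen (X 0) / 2 - h := by
    linarith [single_supp_le (hc t ht) hh (hsupp t ht) φ]
  have hpos : 0 < suppFn X t φ - h := by linarith
  have hk : curv (X t) φ = (suppFn X t φ - h) * phi4 X h t φ := by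
    simp only [phi4]
    rw [mul_div_cancel₀ _ hpos.ne']
  have hM : 0 ≤ max (phi4Max X h) (2 / h ^ 2) := le_trans (by positivity) (le_max_right _ _)
  have hm : min (phi4Min X h) (-(2 * π) / (Real.sqrt (4 * π * A₀) * h)) ≤ 0 := by
    refine (min_le_right _ _).trans (div_nonpos_of_nonpos_of_nonneg ?_ (by positivity))
    linarith [Real.pi_pos]
  rw [hk]
  constructor
  · exact (mul_le_mul_of_nonneg_left b1 hpos.le).trans (mul_le_mul_of_nonneg_right hle hM)
  · exact (mul_le_mul_of_nonpos_right hle hm).trans (mul_le_mul_of_nonneg_left b2 hpos.le)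
end
end
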